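/- Murnaghan–Nakayama rule for K-k-Schur functions in partition form: with the data below, for every 1 ≤ r ≤ k and every λ ∈ 𝒫_k, one has p^R_r g_λ = Σ_μ (−1)^{r − |μ| + |λ|} ( Σ_{i=0}^{r−1} (−1)^i |V^{r,μ}_{i,wc}| + Σ_{i=1}^{r−1} (−1)^i (r−i) |U^{r,μ}_{i−1,wc}| + Σ_{i=1}^{r−2} (−1)^i |U^{r,μ}_{i−1,w̄c,left}| ) g_μ, where X^{r,μ}_• = {u ∈ X^r_• : u * λ = μ} (star action on k-bounded partitions), and the sum runs over those μ ∈ 𝒫_k satisfying: (K0) λ ⊆ μ and λ^{(k)} ⊆ μ^{(k)}; (K1) |μ/λ| ≤ r; (K2) 𝔭^{-1}(μ)/𝔭^{-1}(λ) is a ribbon; (K3) supp(𝔭^{-1}(μ)/𝔭^{-1}(λ)) is k-connected or has cardinality strictly less than r; (K4) ht(μ/λ) + ht(μ^{(k)}/λ^{(k)}) < r. (In particular the coefficient of g_μ vanishes for every μ failing one of (K0)–(K4).) -/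

import Mathlib

open scoped BigOperators Classical

noncomputable section

namespace MN

/-! ## Residues, words, canonical cyclic intervals -/

/-- The residues `ℤ/(k+1)ℤ`. -/
abbrev Idx (k : ℕ) := ZMod (k + 1)

/-- A word in the generators, recorded by its list of indices. -/
abbrev Word (k : ℕ) := List (Idx k)

/-- The support of a word. -/
def supp (k : ℕ) (u : Word k) : Finset (Idx k) := u.toFinset

/-- The smallest `a ∈ {0,…,k}` (as a natural number) with `(a : ℤ/(k+1)) ∉ S`. -/
def gapNat (k : ℕ) (S : Finset (Idx k)) : ℕ :=
  if h : ∃ m : ℕ, m ≤ k ∧ (m : Idx k) ∉ S then Nat.find h else 0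

/-- The gap element `a` of a proper subset `S`. -/
def gap (k : ℕ) (S : Finset (Idx k)) : Idx k := (gapNat k S : Idx k)

/-- Position of a residue `i` in the canonical cyclic interval
`I_S : a+1 < a+2 < ⋯ < k < 0 < ⋯ < a−1` (the gap `a` itself gets the junk position `k`). -/
def pos (k : ℕ) (S : Finset (Idx k)) (i : Idx k) : ℕ := (i - gap k S - 1).val

/-- The list of positions of the letters of `u` in the canonical cyclic interval of its support. -/
def posList (k : ℕ) (u : Word k) : List ℕ := u.map (pos k (supp k u))

/-- A weak hook word of hook type V:
`i₁ > ⋯ > i_j < i_{j+1} < ⋯ < i_m` with respect to `I_{supp u}`. -/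
def IsHookV (k : ℕ) (u : Word k) : Prop :=
  supp k u ≠ Finset.univ ∧
    ∃ (ds as : List ℕ) (v : ℕ),
      posList k u = ds ++ v :: as ∧
        List.Chain' (· > ·) (ds ++ [v]) ∧ List.Chain' (· < ·) (v :: as)

/-- A weak hook word of hook type U:
`i₁ > ⋯ > i_j = i_{j+1} < ⋯ < i_m` with respect to `I_{supp u}`. -/
def IsHookU (k : ℕ) (u : Word k) : Prop :=
  supp k u ≠ Finset.univ ∧
    ∃ (ds as : List ℕ) (v : ℕ),
      posList k u = ds ++ v :: v :: as ∧
        List.Chain' (· > ·) (ds ++ [v]) ∧ List.Chain' (· < ·) (v :: as)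

/-- A weak hook word. -/
def IsWeakHook (k : ℕ) (u : Word k) : Prop := IsHookV k u ∨ IsHookU k u

/-- The number of ascents `i_t < i_{t+1}` of a word. -/
def asc (k : ℕ) (u : Word k) : ℕ :=
  ((posList k u).zip (posList k u).tail).countP fun p => decide (p.1 < p.2)

/-- The candidates `c` in the definition of `u_min`: letters `c` of `u` for which there is a
letter `a` of `u` with `a < c` in `I_{supp u}`, `a + 1 ≠ c`, and no letter `b` of `u` satisfies
`a < b < c`. -/
def uminCands (k : ℕ) (u : Word k) : Finset (Idx k) :=
  (supp k u).filter fun c =>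
    ∃ a ∈ supp k u,
      pos k (supp k u) a < pos k (supp k u) c ∧ a + 1 ≠ c ∧
        ∀ b ∈ supp k u,
          ¬(pos k (supp k u) a < pos k (supp k u) b ∧
            pos k (supp k u) b < pos k (supp k u) c)

/-- The letter `u_min` of `u` (junk value `0` if there is no candidate). -/
def umin (k : ℕ) (u : Word k) : Idx k :=
  if h : (uminCands k u).Nonempty then
    ((uminCands k u).exists_min_image (pos k (supp k u)) h).choose
  else 0

/-- The number of occurrences of `u_min` in `u` (`0` if there is no candidate). -/
def uminCount (k : ℕ) (u : Word k) : ℕ :=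
  if (uminCands k u).Nonempty then u.count (umin k u) else 0

/-- A set of residues is `k`-connected if it is a proper subset of `{0,…,k}` which is an
interval with respect to its canonical cyclic interval order. -/
def IsKConnectedSet (k : ℕ) (S : Finset (Idx k)) : Prop :=
  S ≠ Finset.univ ∧
    ∀ i ∈ S, ∀ j ∈ S, ∀ m : Idx k,
      pos k S i ≤ pos k S m → pos k S m ≤ pos k S j → m ∈ S

/-- A word is `k`-connected if its support is. -/
def IsKConnected (k : ℕ) (u : Word k) : Prop := IsKConnectedSet k (supp k u)

/-- A word is `k`-weak connected if `u_min` occurs `0` or `2` times in it. -/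
def IsWeakConnected (k : ℕ) (u : Word k) : Prop :=
  uminCount k u = 0 ∨ uminCount k u = 2

/-- The letter `c` lies on the left side (the maximal strictly decreasing initial segment) of
the hook form of `u`: equivalently, it occurs in some strictly decreasing initial segment. -/
def OnLeftSide (k : ℕ) (u : Word k) (c : Idx k) : Prop :=
  ∃ p q : Word k, u = p ++ q ∧
    List.Chain' (fun a b => pos k (supp k u) b < pos k (supp k u) a) p ∧ c ∈ p

/-- The letter `c` lies on the right side (the maximal strictly increasing final segment) of
the hook form of `u`. -/
def OnRightSide (k : ℕ) (u : Word k) (c : Idx k) : Prop :=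
  ∃ p q : Word k, u = p ++ q ∧
    List.Chain' (fun a b => pos k (supp k u) a < pos k (supp k u) b) q ∧ c ∈ q

/-! ## The sets `X^r_i` and their refinements (indexed by `i : ℤ`, empty for `i < 0`) -/

/-- `V^r_i`: weak hook words of hook type V, weak length `r`, `asc = i`. -/
def VSet (k r : ℕ) (i : ℤ) : Set (Word k) :=
  {u | IsHookV k u ∧ u.length = r ∧ (asc k u : ℤ) = i}

/-- `U^r_i`. -/
def USet (k r : ℕ) (i : ℤ) : Set (Word k) :=
  {u | IsHookU k u ∧ u.length = r ∧ (asc k u : ℤ) = i}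

/-- `V^r_{i,wc}`: the `k`-weak connected members of `V^r_i`. -/
def VSetWC (k r : ℕ) (i : ℤ) : Set (Word k) := {u ∈ VSet k r i | IsWeakConnected k u}

/-- `U^r_{i,wc}`. -/
def USetWC (k r : ℕ) (i : ℤ) : Set (Word k) := {u ∈ USet k r i | IsWeakConnected k u}

/-- `V^r_{i,c}`: the `k`-connected members of `V^r_i`. -/
def VSetC (k r : ℕ) (i : ℤ) : Set (Word k) := {u ∈ VSet k r i | IsKConnected k u}

/-- `V^r_{i,w̄c,left}`. -/
def VSetNWCL (k r : ℕ) (i : ℤ) : Set (Word k) :=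
  {u ∈ VSet k r i | ¬IsWeakConnected k u ∧ OnLeftSide k u (umin k u)}

/-- `V^r_{i,w̄c,right}`. -/
def VSetNWCR (k r : ℕ) (i : ℤ) : Set (Word k) :=
  {u ∈ VSet k r i | ¬IsWeakConnected k u ∧ OnRightSide k u (umin k u)}

/-- `U^r_{i,w̄c,left}`. -/
def USetNWCL (k r : ℕ) (i : ℤ) : Set (Word k) :=
  {u ∈ USet k r i | ¬IsWeakConnected k u ∧ OnLeftSide k u (umin k u)}

/-- `U^r_{i,w̄c,right}`. -/
def USetNWCR (k r : ℕ) (i : ℤ) : Set (Word k) :=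
  {u ∈ USet k r i | ¬IsWeakConnected k u ∧ OnRightSide k u (umin k u)}

/-! ## The algebras `𝒜_k`, `ℋ_k`, `𝒩_k` -/

/-- The defining relations of `𝒜_k`. -/
inductive AkRel (k : ℕ) : FreeAlgebra ℤ (Idx k) → FreeAlgebra ℤ (Idx k) → Prop
  | braid (i : Idx k) :
      AkRel k (FreeAlgebra.ι ℤ i * FreeAlgebra.ι ℤ (i + 1) * FreeAlgebra.ι ℤ i)
        (FreeAlgebra.ι ℤ (i + 1) * FreeAlgebra.ι ℤ i * FreeAlgebra.ι ℤ (i + 1))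
  | comm (i j : Idx k) (h1 : i - j ≠ 1) (h2 : j - i ≠ 1) :
      AkRel k (FreeAlgebra.ι ℤ i * FreeAlgebra.ι ℤ j)
        (FreeAlgebra.ι ℤ j * FreeAlgebra.ι ℤ i)

/-- The algebra `𝒜_k`. -/
abbrev Ak (k : ℕ) := RingQuot (AkRel k)

/-- The generator `A_i` of `𝒜_k`. -/
def Agen (k : ℕ) (i : Idx k) : Ak k := RingQuot.mkAlgHom ℤ (AkRel k) (FreeAlgebra.ι ℤ i)

/-- The element `A_{i₁} ⋯ A_{i_m}` of `𝒜_k` associated to a word. -/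
def Aword (k : ℕ) (u : Word k) : Ak k := (u.map (Agen k)).prod

/-- The defining relations of the 0-Hecke algebra `ℋ_k`. -/
inductive HkRel (k : ℕ) : FreeAlgebra ℤ (Idx k) → FreeAlgebra ℤ (Idx k) → Prop
  | braid (i : Idx k) :
      HkRel k (FreeAlgebra.ι ℤ i * FreeAlgebra.ι ℤ (i + 1) * FreeAlgebra.ι ℤ i)
        (FreeAlgebra.ι ℤ (i + 1) * FreeAlgebra.ι ℤ i * FreeAlgebra.ι ℤ (i + 1))
  | comm (i j : Idx k) (h1 : i - j ≠ 1) (h2 : j - i ≠ 1) :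
      HkRel k (FreeAlgebra.ι ℤ i * FreeAlgebra.ι ℤ j)
        (FreeAlgebra.ι ℤ j * FreeAlgebra.ι ℤ i)
  | sq (i : Idx k) :
      HkRel k (FreeAlgebra.ι ℤ i * FreeAlgebra.ι ℤ i) (-(FreeAlgebra.ι ℤ i))

/-- The 0-Hecke algebra `ℋ_k`. -/
abbrev Hk (k : ℕ) := RingQuot (HkRel k)

/-- The generator `H_i`. -/
def Hgen (k : ℕ) (i : Idx k) : Hk k := RingQuot.mkAlgHom ℤ (HkRel k) (FreeAlgebra.ι ℤ i)

/-- The element `H_{i₁} ⋯ H_{i_m}`. -/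
def Hword (k : ℕ) (u : Word k) : Hk k := (u.map (Hgen k)).prod

/-- The defining relations of the nilCoxeter algebra `𝒩_k`. -/
inductive NkRel (k : ℕ) : FreeAlgebra ℤ (Idx k) → FreeAlgebra ℤ (Idx k) → Prop
  | braid (i : Idx k) :
      NkRel k (FreeAlgebra.ι ℤ i * FreeAlgebra.ι ℤ (i + 1) * FreeAlgebra.ι ℤ i)
        (FreeAlgebra.ι ℤ (i + 1) * FreeAlgebra.ι ℤ i * FreeAlgebra.ι ℤ (i + 1))
  | comm (i j : Idx k) (h1 : i - j ≠ 1) (h2 : j - i ≠ 1) :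
      NkRel k (FreeAlgebra.ι ℤ i * FreeAlgebra.ι ℤ j)
        (FreeAlgebra.ι ℤ j * FreeAlgebra.ι ℤ i)
  | sq (i : Idx k) :
      NkRel k (FreeAlgebra.ι ℤ i * FreeAlgebra.ι ℤ i) 0

/-- The nilCoxeter algebra `𝒩_k`. -/
abbrev Nk (k : ℕ) := RingQuot (NkRel k)

/-- The generator `N_i`. -/
def Ngen (k : ℕ) (i : Idx k) : Nk k := RingQuot.mkAlgHom ℤ (NkRel k) (FreeAlgebra.ι ℤ i)

/-- The element `N_{i₁} ⋯ N_{i_m}`. -/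
def Nword (k : ℕ) (u : Word k) : Nk k := (u.map (Ngen k)).prod

/-! ## The affine symmetric group -/

/-- The relators of the affine symmetric group `S̃_{k+1}`. -/
def CoxRels (k : ℕ) : Set (FreeGroup (Idx k)) :=
  {g | (∃ i : Idx k, g = FreeGroup.of i * FreeGroup.of i) ∨
    (∃ i : Idx k,
      g = FreeGroup.of i * FreeGroup.of (i + 1) * FreeGroup.of i *
        (FreeGroup.of (i + 1) * FreeGroup.of i * FreeGroup.of (i + 1))⁻¹) ∨
    (∃ i j : Idx k, i - j ≠ 1 ∧ j - i ≠ 1 ∧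
      g = FreeGroup.of i * FreeGroup.of j * (FreeGroup.of j * FreeGroup.of i)⁻¹)}

/-- The affine symmetric group `S̃_{k+1}`. -/
abbrev AffS (k : ℕ) := PresentedGroup (CoxRels k)

/-- The generator `s_i`. -/
def sgen (k : ℕ) (i : Idx k) : AffS k := PresentedGroup.of i

/-- The product `s_{i₁} ⋯ s_{i_m}`. -/
def sword (k : ℕ) (u : Word k) : AffS k := (u.map (sgen k)).prod

/-- The Coxeter length of `w ∈ S̃_{k+1}`. -/
def len (k : ℕ) (w : AffS k) : ℕ :=
  sInf {m | ∃ u : Word k, u.length = m ∧ sword k u = w}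

/-- `u` is a reduced word. -/
def IsReducedWord (k : ℕ) (u : Word k) : Prop := len k (sword k u) = u.length

/-- The finite symmetric group `S_{k+1} = ⟨s_1, …, s_k⟩` inside `S̃_{k+1}`. -/
def FinSub (k : ℕ) : Subgroup (AffS k) :=
  Subgroup.closure {g | ∃ i : Idx k, i ≠ 0 ∧ g = sgen k i}

/-- `w` is a minimal-length coset representative of `S̃_{k+1}/S_{k+1}` (a Grassmannian
element). -/
def IsGrassmannian (k : ℕ) (w : AffS k) : Prop :=
  ∀ v : AffS k, w⁻¹ * v ∈ FinSub k → len k w ≤ len k v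

/-! ## Anti-weak hook words -/

/-- Anti-weak hook word, first form: `i₁ < ⋯ < i_j > i_{j+1} > ⋯ > i_m`. -/
def IsAntiHookV (k : ℕ) (u : Word k) : Prop :=
  supp k u ≠ Finset.univ ∧
    ∃ (ds as : List ℕ) (v : ℕ),
      posList k u = ds ++ v :: as ∧
        List.Chain' (· < ·) (ds ++ [v]) ∧ List.Chain' (· > ·) (v :: as)

/-- Anti-weak hook word, second form: `i₁ < ⋯ < i_j = i_{j+1} > ⋯ > i_m`. -/
def IsAntiHookU (k : ℕ) (u : Word k) : Prop :=
  supp k u ≠ Finset.univ ∧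
    ∃ (ds as : List ℕ) (v : ℕ),
      posList k u = ds ++ v :: v :: as ∧
        List.Chain' (· < ·) (ds ++ [v]) ∧ List.Chain' (· > ·) (v :: as)

/-- Anti-weak hook word. -/
def IsAntiWeakHook (k : ℕ) (u : Word k) : Prop := IsAntiHookV k u ∨ IsAntiHookU k u

/-- Length of the maximal strictly increasing (w.r.t. `I_{supp u}`) initial segment of `u`
(= the left side of an anti-weak hook word). -/
def incPrefixLen (k : ℕ) (u : Word k) : ℕ :=
  sSup {n | n ≤ u.length ∧
    List.Chain' (fun a b => pos k (supp k u) a < pos k (supp k u) b) (u.take n)}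

/-- Length of the maximal strictly increasing (w.r.t. `I_{supp u}`) final segment of `u`
(= the right side of a weak hook word). -/
def incSuffixLen (k : ℕ) (u : Word k) : ℕ :=
  sSup {n | n ≤ u.length ∧
    List.Chain' (fun a b => pos k (supp k u) a < pos k (supp k u) b)
      (u.drop (u.length - n))}

/-! ## Noncommutative symmetric functions in `𝒜_k` -/

/-- The word underlying the cyclically decreasing element `d_A` (letters of `A` in decreasing
position order, so that `A_{i+1}` occurs before `A_i` whenever `i, i+1 ∈ A`). -/
def dwordOf (k : ℕ) (A : Finset (Idx k)) : Word k :=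
  (((A.image (pos k A)).sort (· ≤ ·)).reverse).map fun n => gap k A + 1 + (n : Idx k)

/-- The word underlying the cyclically increasing element `i_A`. -/
def iwordOf (k : ℕ) (A : Finset (Idx k)) : Word k :=
  ((A.image (pos k A)).sort (· ≤ ·)).map fun n => gap k A + 1 + (n : Idx k)

/-- The noncommutative homogeneous symmetric function `h_r = Σ_{|A| = r} d_A`. -/
def hFun (k r : ℕ) : Ak k :=
  ∑ A ∈ Finset.powersetCard r (Finset.univ : Finset (Idx k)), Aword k (dwordOf k A)

/-- The noncommutative elementary symmetric function `e_r = Σ_{|A| = r} i_A`. -/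
def eFun (k r : ℕ) : Ak k :=
  ∑ A ∈ Finset.powersetCard r (Finset.univ : Finset (Idx k)), Aword k (iwordOf k A)

/-- The noncommutative hook Schur function `s_{(r−i,1^i)}`. -/
def sHookFun (k r i : ℕ) : Ak k :=
  ∑ j ∈ Finset.range (i + 1), ((-1 : ℤ) ^ j) • (hFun k (r - i + j) * eFun k (i - j))

/-- The noncommutative power sum `p_r`. -/
def pFun (k r : ℕ) : Ak k :=
  ∑ i ∈ Finset.range r, ((-1 : ℤ) ^ i) • sHookFun k r i

/-! ## Actions on the affine symmetric group -/

/-- The star action of a generator: `A_i * w = s_i w` if `l(s_i w) > l(w)`, else `w`. -/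
def starG (k : ℕ) (i : Idx k) (w : AffS k) : AffS k :=
  if len k w < len k (sgen k i * w) then sgen k i * w else w

/-- The star action of a word: `A_{i₁}⋯A_{i_m} * w = A_{i₁} * (⋯ * (A_{i_m} * w))`. -/
def starW (k : ℕ) (u : Word k) (w : AffS k) : AffS k := u.foldr (starG k) w

/-- The dot action of a generator, with values in `S̃_{k+1} ∪ {0}`. -/
def dotG (k : ℕ) (i : Idx k) : Option (AffS k) → Option (AffS k)
  | none => none
  | some w => if len k w < len k (sgen k i * w) then some (sgen k i * w) else none

/-- The dot action of a word. -/
def dotW (k : ℕ) (u : Word k) (o : Option (AffS k)) : Option (AffS k) :=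
  u.foldr (dotG k) o

/-- Extension of an action datum `act : generator → S̃ → S̃ ∪ {0}` to `S̃ ∪ {0}`. -/
def actExt (k : ℕ) (act : Idx k → AffS k → Option (AffS k)) (i : Idx k) :
    Option (AffS k) → Option (AffS k)
  | none => none
  | some w => act i w

/-- Extension of an action datum to words. -/
def actW (k : ℕ) (act : Idx k → AffS k → Option (AffS k)) (u : Word k)
    (o : Option (AffS k)) : Option (AffS k) :=
  u.foldr (actExt k act) o

/-! ## Rings and coefficients -/

/-- `(−1)^n` for an integer exponent `n`, in any ring. -/
def msign (R : Type*) [Ring R] (n : ℤ) : R := (((-1 : Rˣ) ^ n : Rˣ) : R)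

/-- The power sum `p^R_r = Σ_{i=0}^{r−1} Σ_{j=0}^{i} (−1)^{i+j} h^R_{r−i+j} e^R_{i−j}` built from
Pieri data in a commutative ring. -/
def pR {R : Type*} [CommRing R] (h e : ℕ → R) (r : ℕ) : R :=
  ∑ i ∈ Finset.range r, ∑ j ∈ Finset.range (i + 1),
    ((-1 : ℤ) ^ (i + j)) • (h (r - i + j) * e (i - j))

/-- The integer coefficient
`Σ_{i=0}^{r−1} (−1)^i |V^r_{i,wc} ∩ P| + Σ_{i=1}^{r−1} (−1)^i (r−i) |U^r_{i−1,wc} ∩ P|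
 + Σ_{i=1}^{r−2} (−1)^i |U^r_{i−1,w̄c,left} ∩ P|`. -/
def MNcoeff (k r : ℕ) (P : Word k → Prop) : ℤ :=
  (∑ i ∈ Finset.range r, (-1 : ℤ) ^ i * ({u ∈ VSetWC k r (i : ℤ) | P u}.ncard : ℤ)) +
    (∑ i ∈ Finset.Icc 1 (r - 1),
      (-1 : ℤ) ^ i * ((r : ℤ) - i) * ({u ∈ USetWC k r ((i : ℤ) - 1) | P u}.ncard : ℤ)) +
    ∑ i ∈ Finset.Icc 1 (r - 2),
      (-1 : ℤ) ^ i * ({u ∈ USetNWCL k r ((i : ℤ) - 1) | P u}.ncard : ℤ)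

/-- The integer coefficient `Σ_{i=0}^{r−1} (−1)^i |V^r_{i,c} ∩ P|`. -/
def kcoeff (k r : ℕ) (P : Word k → Prop) : ℤ :=
  ∑ i ∈ Finset.range r, (-1 : ℤ) ^ i * ({u ∈ VSetC k r (i : ℤ) | P u}.ncard : ℤ)

/-! ## Partitions, cores, bounded partitions -/

/-- A cell of a Young diagram: (row, column), `0`-indexed. -/
abbrev Cell := ℕ × ℕ

/-- A (finite) Young diagram, as a finite lower set of cells. -/
def IsYoung (S : Set Cell) : Prop :=
  S.Finite ∧ ∀ p ∈ S, ∀ q : Cell, q.1 ≤ p.1 → q.2 ≤ p.2 → q ∈ S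

/-- The `(k+1)`-residue of a cell `(i,j)`, i.e. `j − i mod (k+1)`. -/
def res (k : ℕ) (c : Cell) : Idx k := (c.2 : Idx k) - (c.1 : Idx k)

/-- The hook length of a cell: arm + leg + 1. -/
def hookLen (S : Set Cell) (c : Cell) : ℕ :=
  {j | c.2 < j ∧ (c.1, j) ∈ S}.ncard + {i | c.1 < i ∧ (i, c.2) ∈ S}.ncard + 1

/-- A `(k+1)`-core: a partition with no cell of hook length `k+1`. -/
def IsCore (k : ℕ) (S : Set Cell) : Prop :=
  IsYoung S ∧ ∀ c ∈ S, hookLen S c ≠ k + 1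

/-- A `k`-bounded partition: every part is at most `k`. -/
def IsBounded (k : ℕ) (S : Set Cell) : Prop :=
  IsYoung S ∧ ∀ c ∈ S, c.2 < k

/-- A removable corner of `S`. -/
def Removable (S : Set Cell) (c : Cell) : Prop :=
  c ∈ S ∧ (c.1 + 1, c.2) ∉ S ∧ (c.1, c.2 + 1) ∉ S

/-- An addable corner of `S`: a cell not in `S` whose addition yields a partition. -/
def Addable (S : Set Cell) (c : Cell) : Prop :=
  c ∉ S ∧ IsYoung (S ∪ {c})

/-- The map `𝔭` from `(k+1)`-cores to `k`-bounded partitions: row `i` of `𝔭(κ)` has as many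
cells as there are cells of hook length at most `k` in row `i` of `κ`. -/
def pMap (k : ℕ) (S : Set Cell) : Set Cell :=
  {c | c.2 < {j | (c.1, j) ∈ S ∧ hookLen S (c.1, j) ≤ k}.ncard}

/-- The inverse bijection `𝔭^{-1}` from `k`-bounded partitions to `(k+1)`-cores. -/
def pInv (k : ℕ) (lam : Set Cell) : Set Cell :=
  Function.invFunOn (pMap k) {S | IsCore k S} lam

/-- The transpose (conjugate) of a diagram. -/
def transposeSet (S : Set Cell) : Set Cell := {c | (c.2, c.1) ∈ S}

/-- The `k`-conjugate `λ^{(k)} = 𝔭((𝔭^{-1} λ)^t)`. -/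
def kconj (k : ℕ) (lam : Set Cell) : Set Cell := pMap k (transposeSet (pInv k lam))

/-- A skew shape is a ribbon if it contains no `2×2` square. -/
def IsRibbon (D : Set Cell) : Prop :=
  ∀ c : Cell, ¬((c.1, c.2) ∈ D ∧ (c.1 + 1, c.2) ∈ D ∧
    (c.1, c.2 + 1) ∈ D ∧ (c.1 + 1, c.2 + 1) ∈ D)

/-- A vertical strip: no two cells in the same row. -/
def IsVStrip (D : Set Cell) : Prop :=
  ∀ c ∈ D, ∀ c' ∈ D, c.1 = c'.1 → c = c'

/-- A horizontal strip: no two cells in the same column. -/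
def IsHStrip (D : Set Cell) : Prop :=
  ∀ c ∈ D, ∀ c' ∈ D, c.2 = c'.2 → c = c'

/-- The height of a skew shape: the number of occupied rows minus the number of connected
components; each connected component is counted by its unique last occupied row, i.e. an
occupied row sharing no column with the next row. -/
def htSkew (D : Set Cell) : ℕ :=
  {i : ℕ | ∃ j, (i, j) ∈ D}.ncard -
    {i : ℕ | (∃ j, (i, j) ∈ D) ∧ ¬∃ j, (i, j) ∈ D ∧ (i + 1, j) ∈ D}.ncard

/-- The set of `(k+1)`-residues of the cells of a skew shape. -/
def residSupp (k : ℕ) (D : Set Cell) : Finset (Idx k) :=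
  Set.Finite.toFinset (Set.toFinite (res k '' D))

/-! ## Star and dot actions on cores and on `k`-bounded partitions -/

/-- The star action of `A_i` on `(k+1)`-cores together with `0`. -/
def starC (k : ℕ) (i : Idx k) : Option (Set Cell) → Option (Set Cell)
  | none => none
  | some S =>
    if ∃ c, Addable S c ∧ res k c = i then some (S ∪ {c | Addable S c ∧ res k c = i})
    else if ∃ c, Removable S c ∧ res k c = i then some S
    else none

/-- The star action of a word on cores. -/
def starCW (k : ℕ) (u : Word k) (o : Option (Set Cell)) : Option (Set Cell) :=
  u.foldr (starC k) o

/-- The star action of a word on `k`-bounded partitions, transported through `𝔭`. -/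
def starB (k : ℕ) (u : Word k) (lam : Set Cell) : Option (Set Cell) :=
  (starCW k u (some (pInv k lam))).map (pMap k)

/-- The dot action of `A_i` on `(k+1)`-cores together with `0`. -/
def dotC (k : ℕ) (i : Idx k) : Option (Set Cell) → Option (Set Cell)
  | none => none
  | some S =>
    if ∃ c, Addable S c ∧ res k c = i then some (S ∪ {c | Addable S c ∧ res k c = i})
    else none

/-- The dot action of a word on cores. -/
def dotCW (k : ℕ) (u : Word k) (o : Option (Set Cell)) : Option (Set Cell) :=
  u.foldr (dotC k) o

/-- The dot action of a word on `k`-bounded partitions, transported through `𝔭`. -/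
def dotB (k : ℕ) (u : Word k) (lam : Set Cell) : Option (Set Cell) :=
  (dotCW k u (some (pInv k lam))).map (pMap k)

/-- The number of maximal segments of consecutive letters (w.r.t. the positions for `S`) of a
word `V`. -/
def numSegments (k : ℕ) (S : Finset (Idx k)) (V : Word k) : ℕ :=
  if V.length = 0 then 0
  else ((V.zip V.tail).countP fun p => decide (pos k S p.2 ≠ pos k S p.1 + 1)) + 1

/-- Conditions (K0)–(K4) of the Murnaghan–Nakayama rule for `K`-`k`-Schur functions. -/
def Kconds (k r : ℕ) (lam mu : Set Cell) : Prop :=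
  lam ⊆ mu ∧ kconj k lam ⊆ kconj k mu ∧
    (mu \ lam).ncard ≤ r ∧
    IsRibbon (pInv k mu \ pInv k lam) ∧
    (IsKConnectedSet k (residSupp k (pInv k mu \ pInv k lam)) ∨
      (residSupp k (pInv k mu \ pInv k lam)).card < r) ∧
    htSkew (mu \ lam) + htSkew (kconj k mu \ kconj k lam) < r

/-- Conditions (k0)–(k4) of the Murnaghan–Nakayama rule for `k`-Schur functions. -/
def kconds (k r : ℕ) (lam mu : Set Cell) : Prop :=
  lam ⊆ mu ∧ kconj k lam ⊆ kconj k mu ∧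
    (mu \ lam).ncard = r ∧
    IsRibbon (pInv k mu \ pInv k lam) ∧
    IsKConnectedSet k (residSupp k (pInv k mu \ pInv k lam)) ∧
    htSkew (mu \ lam) + htSkew (kconj k mu \ kconj k lam) = r - 1



/-! # Part A: words -/

/-- position relative to a gap -/
def pg (k : ℕ) (g i : Idx k) : ℕ := (i - g - 1).val

def iw (k : ℕ) (g : Idx k) (A : Finset (Idx k)) : Word k :=
  ((A.image (pg k g)).sort (· ≤ ·)).map fun n : ℕ => g + 1 + (n : Idx k)

def dw (k : ℕ) (g : Idx k) (A : Finset (Idx k)) : Word k := (iw k g A).reverse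

lemma lift_eq {k : ℕ} (l : List ℕ) :
    (do let a ← l; pure (a : Idx k)) = l.map (fun n : ℕ => (n : Idx k)) := by
  induction l with
  | nil => rfl
  | cons x t ih =>
    simp only [List.map_cons]
    rw [← ih]; rfl

lemma iwordOf_eq (k : ℕ) (A : Finset (Idx k)) : iwordOf k A = iw k (gap k A) A := by
  unfold iwordOf iw
  rw [lift_eq, List.map_map]; rfl

lemma dwordOf_eq (k : ℕ) (A : Finset (Idx k)) : dwordOf k A = dw k (gap k A) A := by
  unfold dwordOf dw iw
  rw [lift_eq, List.map_map, List.map_reverse]; rfl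

lemma pos_eq (k : ℕ) (S : Finset (Idx k)) (i : Idx k) : pos k S i = pg k (gap k S) i := rfl

lemma pg_inv (k : ℕ) (g i : Idx k) : g + 1 + (pg k g i : Idx k) = i := by
  simp [pg]

lemma pg_inj (k : ℕ) (g : Idx k) : Function.Injective (pg k g) := by
  intro a b h
  rw [← pg_inv k g a, h, pg_inv]

lemma pg_succ (k : ℕ) (g x : Idx k) (hx : x ≠ g) : pg k g (x + 1) = pg k g x + 1 := by
  unfold pg
  have h1 : x + 1 - g - 1 = (x - g - 1) + 1 := by ring
  rw [h1]
  rcases (show (x - g - 1).val < k ∨ (x - g - 1).val = k by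
    have := ZMod.val_lt (x - g - 1); omega) with h | h
  · by_cases hk : k = 0
    · omega
    have : Fact (1 < k + 1) := ⟨by omega⟩
    rw [ZMod.val_add_of_lt]
    · rw [ZMod.val_one]
    · rw [ZMod.val_one]; omega
  · exfalso
    apply hx
    have h2 : x - g - 1 = (k : Idx k) := by
      have h5 := ZMod.natCast_zmod_val (x - g - 1)
      rw [← h5]; exact congrArg _ h
    have h3 : ((k : Idx k)) + 1 = 0 := by
      have := ZMod.natCast_self (k + 1)
      push_cast at this; exact this
    have : x - g = 0 := by
      have h4 : x - g = (x - g - 1) + 1 := by ring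
      rw [h4, h2, h3]
    exact sub_eq_zero.mp this

lemma iw_pairwise (k : ℕ) (g : Idx k) (A : Finset (Idx k)) :
    (iw k g A).Pairwise (fun x y => pg k g x < pg k g y) := by
  unfold iw
  rw [List.pairwise_map]
  have h := Finset.sortedLT_sort (A.image (pg k g))
  have h2 := h.pairwise
  refine List.Pairwise.imp_of_mem ?_ h2
  intro a b ha hb hab
  rw [Finset.mem_sort, Finset.mem_image] at ha hb
  obtain ⟨x, -, rfl⟩ := ha
  obtain ⟨y, -, rfl⟩ := hb
  rwa [pg_inv, pg_inv]

lemma mem_iw {k : ℕ} {g : Idx k} {A : Finset (Idx k)} {x : Idx k} : x ∈ iw k g A ↔ x ∈ A := by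
  unfold iw
  simp only [List.mem_map, Finset.mem_sort, Finset.mem_image]
  constructor
  · rintro ⟨_, ⟨y, hy, rfl⟩, rfl⟩
    rwa [pg_inv]
  · intro h
    exact ⟨_, ⟨x, h, rfl⟩, pg_inv k g x⟩

lemma mem_dw {k : ℕ} {g : Idx k} {A : Finset (Idx k)} {x : Idx k} : x ∈ dw k g A ↔ x ∈ A := by
  unfold dw; rw [List.mem_reverse, mem_iw]

lemma dw_pairwise (k : ℕ) (g : Idx k) (A : Finset (Idx k)) :
    (dw k g A).Pairwise (fun x y => pg k g y < pg k g x) := by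
  unfold dw; rw [List.pairwise_reverse]; exact iw_pairwise k g A

lemma iw_unique {k : ℕ} {g : Idx k} {A : Finset (Idx k)} {l : Word k}
    (hl : l.Pairwise (fun x y => pg k g x < pg k g y)) (hm : ∀ x, x ∈ l ↔ x ∈ A) :
    l = iw k g A := by
  have n1 : l.Nodup := hl.imp (by intro a b h e; subst e; omega)
  have n2 : (iw k g A).Nodup := (iw_pairwise k g A).imp (by intro a b h e; subst e; omega)
  have hp : l.Perm (iw k g A) := (List.perm_ext_iff_of_nodup n1 n2).2 (by
    intro x; rw [hm, mem_iw])
  refine List.Perm.eq_of_pairwise ?_ hl (iw_pairwise k g A) hp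
  intro a b _ _ h1 h2; omega

lemma dw_unique {k : ℕ} {g : Idx k} {A : Finset (Idx k)} {l : Word k}
    (hl : l.Pairwise (fun x y => pg k g y < pg k g x)) (hm : ∀ x, x ∈ l ↔ x ∈ A) :
    l = dw k g A := by
  unfold dw
  rw [← iw_unique (l := l.reverse) (A := A) (g := g) (by rwa [List.pairwise_reverse])
    (by intro x; rw [List.mem_reverse, hm])]
  simp

lemma iw_nodup (k : ℕ) (g : Idx k) (A : Finset (Idx k)) : (iw k g A).Nodup :=
  (iw_pairwise k g A).imp (by intro a b h e; subst e; omega)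

lemma dw_nodup (k : ℕ) (g : Idx k) (A : Finset (Idx k)) : (dw k g A).Nodup := by
  unfold dw; rw [List.nodup_reverse]; exact iw_nodup k g A

lemma iw_toFinset (k : ℕ) (g : Idx k) (A : Finset (Idx k)) : (iw k g A).toFinset = A := by
  ext x; rw [List.mem_toFinset, mem_iw]

lemma dw_toFinset (k : ℕ) (g : Idx k) (A : Finset (Idx k)) : (dw k g A).toFinset = A := by
  ext x; rw [List.mem_toFinset, mem_dw]

lemma iw_length (k : ℕ) (g : Idx k) (A : Finset (Idx k)) : (iw k g A).length = A.card := by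
  rw [← List.toFinset_card_of_nodup (iw_nodup k g A), iw_toFinset]

lemma dw_length (k : ℕ) (g : Idx k) (A : Finset (Idx k)) : (dw k g A).length = A.card := by
  unfold dw; rw [List.length_reverse, iw_length]

lemma gap_notMem {k : ℕ} {S : Finset (Idx k)} (h : S ≠ Finset.univ) : gap k S ∉ S := by
  have hex : ∃ m : ℕ, m ≤ k ∧ (m : Idx k) ∉ S := by
    by_contra hc
    push Not at hc
    apply h
    rw [Finset.eq_univ_iff_forall]
    intro x
    have := hc x.val (by have := ZMod.val_lt x; omega)
    simpa using this
  unfold gap gapNat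
  rw [dif_pos hex]
  exact (Nat.find_spec hex).2

/-- in d-type words -/
lemma dw_noSucc {k : ℕ} {g : Idx k} {A : Finset (Idx k)} (hg : g ∉ A) :
    (dw k g A).Pairwise (fun x y => y ≠ x + 1) := by
  refine List.Pairwise.imp_of_mem ?_ (dw_pairwise k g A)
  intro a b ha hb hab e
  subst e
  rw [mem_dw] at ha
  rw [pg_succ k g a (by rintro rfl; exact hg ha)] at hab
  omega

lemma iw_noPred {k : ℕ} {g : Idx k} {A : Finset (Idx k)} (hg : g ∉ A) :
    (iw k g A).Pairwise (fun x y => x ≠ y + 1) := by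
  refine List.Pairwise.imp_of_mem ?_ (iw_pairwise k g A)
  intro a b ha hb hab e
  subst e
  rw [mem_iw] at hb
  rw [pg_succ k g b (by rintro rfl; exact hg hb)] at hab
  omega

/-- the trace-monoid lemma -/
lemma prod_eq_of_pairwise {α M : Type*} [Monoid M] (a : α → M) (Rl : α → α → Prop)
    (hc : ∀ x y, Rl x y → Rl y x → Commute (a x) (a y)) :
    ∀ l1 l2 : List α, l1.Perm l2 → l1.Pairwise Rl → l2.Pairwise Rl →
      (l1.map a).prod = (l2.map a).prod := by
  intro l1
  induction l1 with
  | nil => intro l2 hp _ _; rw [List.nil_perm.mp hp]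
  | cons x t ih =>
    intro l2 hp h1 h2
    have hx : x ∈ l2 := hp.subset (by simp)
    obtain ⟨p, q, rfl⟩ := List.append_of_mem hx
    have hp2 : t.Perm (p ++ q) := by
      have : (x :: t).Perm (x :: (p ++ q)) := hp.trans List.perm_middle
      exact (List.perm_cons x).mp this
    rw [List.pairwise_cons] at h1
    have h2' : (p ++ q).Pairwise Rl := h2.sublist (by simp)
    have e := ih (p ++ q) hp2 h1.2 h2'
    rw [List.map_cons, List.prod_cons, e]
    have hcx : ∀ m ∈ p.map a, Commute (a x) m := by
      intro m hm
      rw [List.mem_map] at hm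
      obtain ⟨y, hy, rfl⟩ := hm
      rw [List.pairwise_append] at h2
      exact hc x y (h1.1 y (hp2.symm.subset (by simp [hy]))) (h2.2.2 y hy x (by simp))
    have hcp := Commute.list_prod_right _ _ hcx
    simp only [List.map_append, List.map_cons, List.prod_append, List.prod_cons]
    rw [← mul_assoc, hcp.eq, mul_assoc]

def NonAdj {k : ℕ} (i j : Idx k) : Prop := i ≠ j + 1 ∧ j ≠ i + 1

lemma prod_dw {k : ℕ} {M : Type*} [Monoid M] (a : Idx k → M)
    (hc : ∀ i j, NonAdj i j → Commute (a i) (a j)) {g g' : Idx k} {A : Finset (Idx k)}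
    (hg : g ∉ A) (hg' : g' ∉ A) : ((dw k g A).map a).prod = ((dw k g' A).map a).prod := by
  refine prod_eq_of_pairwise a (fun x y => y ≠ x + 1) (fun x y h1 h2 => hc x y ⟨h2, h1⟩) _ _ ?_
    (dw_noSucc hg) (dw_noSucc hg')
  exact (List.perm_ext_iff_of_nodup (dw_nodup _ _ _) (dw_nodup _ _ _)).2
    (by intro x; rw [mem_dw, mem_dw])

lemma prod_iw {k : ℕ} {M : Type*} [Monoid M] (a : Idx k → M)
    (hc : ∀ i j, NonAdj i j → Commute (a i) (a j)) {g g' : Idx k} {A : Finset (Idx k)}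
    (hg : g ∉ A) (hg' : g' ∉ A) : ((iw k g A).map a).prod = ((iw k g' A).map a).prod := by
  refine prod_eq_of_pairwise a (fun x y => x ≠ y + 1) (fun x y h1 h2 => hc x y ⟨h1, h2⟩) _ _ ?_
    (iw_noPred hg) (iw_noPred hg')
  exact (List.perm_ext_iff_of_nodup (iw_nodup _ _ _) (iw_nodup _ _ _)).2
    (by intro x; rw [mem_iw, mem_iw])

/-- the word of a pair -/
def W (k : ℕ) (p : Finset (Idx k) × Finset (Idx k)) : Word k :=
  dw k (gap k (p.1 ∪ p.2)) p.1 ++ iw k (gap k (p.1 ∪ p.2)) p.2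

lemma supp_W (k : ℕ) (p) : supp k (W k p) = p.1 ∪ p.2 := by
  ext x
  simp [supp, W, mem_dw, mem_iw]

lemma length_W (k : ℕ) (p) : (W k p).length = p.1.card + p.2.card := by
  simp [W, dw_length, iw_length]

lemma iw_min {k : ℕ} {g v : Idx k} {B : Finset (Idx k)} (hv : v ∈ B)
    (hmin : ∀ y ∈ B, pg k g v ≤ pg k g y) : iw k g B = v :: iw k g (B.erase v) := by
  symm
  apply iw_unique
  · rw [List.pairwise_cons]
    refine ⟨?_, iw_pairwise _ _ _⟩
    intro y hy
    rw [mem_iw, Finset.mem_erase] at hy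
    refine lt_of_le_of_ne (hmin y hy.2) ?_
    intro e; exact hy.1 (pg_inj k g e).symm
  · intro x
    rw [List.mem_cons, mem_iw, Finset.mem_erase]
    by_cases h : x = v
    · subst h; simp [hv]
    · simp [h]

lemma dw_min {k : ℕ} {g v : Idx k} {B : Finset (Idx k)} (hv : v ∈ B)
    (hmin : ∀ y ∈ B, pg k g v ≤ pg k g y) : dw k g B = dw k g (B.erase v) ++ [v] := by
  unfold dw
  rw [iw_min hv hmin]; simp

/-- split a dword at c -/
lemma dw_split {k : ℕ} {g c : Idx k} {A : Finset (Idx k)} (hc : c ∈ A) :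
    ∃ p q : Word k, dw k g A = p ++ c :: q ∧ dw k g (A.erase c) = p ++ q ∧
      ∀ y ∈ q, pg k g y < pg k g c := by
  obtain ⟨p, q, h⟩ := List.append_of_mem ((mem_dw (g := g)).2 hc)
  have hpw := dw_pairwise k g A
  have hnd := dw_nodup k g A
  rw [h] at hpw hnd
  refine ⟨p, q, h, ?_, ?_⟩
  · symm
    apply dw_unique
    · exact hpw.sublist (by simp)
    · intro x
      have hm : x ∈ p ++ c :: q ↔ x ∈ A := by rw [← h, mem_dw]
      have hnd2 : c ∉ p ++ q ∧ (p ++ q).Nodup := by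
        have := (List.perm_middle (a := c) (l₁ := p) (l₂ := q)).nodup_iff.mp hnd
        rwa [List.nodup_cons] at this
      rw [Finset.mem_erase, ← hm]
      simp only [List.mem_append, List.mem_cons] at hnd2 ⊢
      constructor
      · rintro h1
        refine ⟨?_, by tauto⟩
        rintro rfl; tauto
      · tauto
  · intro y hy
    rw [List.pairwise_append, List.pairwise_cons] at hpw
    exact hpw.2.1.1 y hy

lemma iw_split {k : ℕ} {g c : Idx k} {A : Finset (Idx k)} (hc : c ∈ A) :
    ∃ p q : Word k, iw k g A = p ++ c :: q ∧ iw k g (A.erase c) = p ++ q ∧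
      ∀ y ∈ p, pg k g y < pg k g c := by
  obtain ⟨p, q, h1, h2, h3⟩ := dw_split (g := g) hc
  refine ⟨q.reverse, p.reverse, ?_, ?_, ?_⟩
  · have := congrArg List.reverse h1
    simpa [dw] using this
  · have := congrArg List.reverse h2
    simpa [dw] using this
  · intro y hy; exact h3 y (by simpa using hy)

/-- toggling a letter that commutes with all smaller letters -/
lemma prod_toggle {k : ℕ} {M : Type*} [Monoid M] (a : Idx k → M) {g c : Idx k}
    {A B : Finset (Idx k)} (hcA : c ∈ A) (hcB : c ∉ B)
    (hcom : ∀ y ∈ A ∪ B, pg k g y < pg k g c → Commute (a c) (a y)) :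
    ((dw k g A ++ iw k g B).map a).prod =
      ((dw k g (A.erase c) ++ iw k g (insert c B)).map a).prod := by
  obtain ⟨p, q, h1, h2, h3⟩ := dw_split (g := g) hcA
  obtain ⟨p', q', h1', h2', h3'⟩ := iw_split (g := g) (Finset.mem_insert_self c B)
  rw [Finset.erase_insert hcB] at h2'
  have cq : Commute (a c) (q.map a).prod := by
    apply Commute.list_prod_right
    intro m hm
    rw [List.mem_map] at hm
    obtain ⟨y, hy, rfl⟩ := hm
    refine hcom y ?_ (h3 y hy)
    have : y ∈ dw k g A := by rw [h1]; simp [hy]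
    rw [mem_dw] at this; simp [this]
  have cp : Commute (a c) (p'.map a).prod := by
    apply Commute.list_prod_right
    intro m hm
    rw [List.mem_map] at hm
    obtain ⟨y, hy, rfl⟩ := hm
    refine hcom y ?_ (h3' y hy)
    have : y ∈ iw k g B := by rw [h2']; simp [hy]
    rw [mem_iw] at this; simp [this]
  rw [h1, h2, h1', h2']
  simp only [List.map_append, List.map_cons, List.prod_append, List.prod_cons]
  have := (cq.mul_right cp).eq
  simp only [mul_assoc] at this ⊢
  rw [← mul_assoc (List.map a p').prod (a c), ← mul_assoc (List.map a q).prod,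
    ← mul_assoc (List.map a q).prod, ← mul_assoc (a c), ← mul_assoc (a c)]
  congr 2
  simp only [mul_assoc]
  exact this

/-! # Part B: the algebraic identity -/

def candsS (k : ℕ) (S : Finset (Idx k)) : Finset (Idx k) :=
  S.filter fun c =>
    ∃ a ∈ S,
      pos k S a < pos k S c ∧ a + 1 ≠ c ∧
        ∀ b ∈ S, ¬(pos k S a < pos k S b ∧ pos k S b < pos k S c)

def umS (k : ℕ) (S : Finset (Idx k)) : Idx k :=
  if h : (candsS k S).Nonempty then
    ((candsS k S).exists_min_image (pos k S) h).choose
  else 0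

lemma uminCands_eq (k : ℕ) (u : Word k) : uminCands k u = candsS k (supp k u) := rfl
lemma umin_eq (k : ℕ) (u : Word k) : umin k u = umS k (supp k u) := rfl

lemma umS_mem {k : ℕ} {S : Finset (Idx k)} (h : (candsS k S).Nonempty) :
    umS k S ∈ candsS k S := by
  unfold umS; rw [dif_pos h]
  exact ((candsS k S).exists_min_image (pos k S) h).choose_spec.1

def mn (k : ℕ) (S : Finset (Idx k)) : Idx k :=
  if h : S.Nonempty then (S.exists_min_image (pos k S) h).choose else 0

lemma mn_mem {k : ℕ} {S : Finset (Idx k)} (h : S.Nonempty) : mn k S ∈ S := by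
  unfold mn; rw [dif_pos h]
  exact (S.exists_min_image (pos k S) h).choose_spec.1

lemma mn_le {k : ℕ} {S : Finset (Idx k)} {y : Idx k} (hy : y ∈ S) :
    pg k (gap k S) (mn k S) ≤ pg k (gap k S) y := by
  have h : S.Nonempty := ⟨y, hy⟩
  unfold mn; rw [dif_pos h]
  exact (S.exists_min_image (pos k S) h).choose_spec.2 y hy

lemma umS_ne_mn {k : ℕ} {S : Finset (Idx k)} (h : (candsS k S).Nonempty) :
    umS k S ≠ mn k S := by
  have h1 := umS_mem h
  unfold candsS at h1
  rw [Finset.mem_filter] at h1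
  obtain ⟨-, a, ha, hlt, -⟩ := h1
  intro e
  have := mn_le ha
  rw [← e] at this
  rw [pos_eq, pos_eq] at hlt
  omega

lemma umS_nonadj {k : ℕ} {S : Finset (Idx k)} (hS : S ≠ Finset.univ) (h : (candsS k S).Nonempty)
    {y : Idx k} (hy : y ∈ S) (hlt : pg k (gap k S) y < pg k (gap k S) (umS k S)) :
    NonAdj (umS k S) y := by
  have h1 := umS_mem h
  unfold candsS at h1
  rw [Finset.mem_filter] at h1
  obtain ⟨hu, a, ha, hal, hne, hb⟩ := h1
  have hg := gap_notMem hS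
  constructor
  · intro e
    have hyg : y ≠ gap k S := by rintro rfl; exact hg hy
    have h2 := pg_succ k _ y hyg
    rw [← e] at h2
    have h3 := hb y hy
    simp only [pos_eq] at h3 hal
    have h4 : pg k (gap k S) a = pg k (gap k S) y := by omega
    exact hne (by rw [pg_inj _ _ h4, ← e])
  · intro e
    have hyg : umS k S ≠ gap k S := by intro e; rw [e] at hu; exact hg hu
    have h2 := pg_succ k _ _ hyg
    rw [← e] at h2
    omega

abbrev Pr (k : ℕ) := Finset (Idx k) × Finset (Idx k)

def Pairs (k r : ℕ) : Finset (Pr k) :=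
  Finset.univ.filter fun p => p.1.card + p.2.card = r

def NPairs (k r : ℕ) : Finset (Pr k) :=
  (Pairs k r).filter fun p => mn k (p.1 ∪ p.2) ∈ p.2

lemma Pairs_ne {k r : ℕ} (hr : r ≤ k) {p : Pr k} (hp : p ∈ Pairs k r) :
    p.1 ∪ p.2 ≠ Finset.univ := by
  intro e
  unfold Pairs at hp
  rw [Finset.mem_filter] at hp
  have h1 := Finset.card_union_le p.1 p.2
  rw [e, Finset.card_univ, ZMod.card] at h1
  omega

lemma Pairs_nonempty {k r : ℕ} (hr : 1 ≤ r) {p : Pr k} (hp : p ∈ Pairs k r) :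
    (p.1 ∪ p.2).Nonempty := by
  rw [Finset.nonempty_iff_ne_empty]
  intro e
  rw [Finset.union_eq_empty] at e
  unfold Pairs at hp
  rw [Finset.mem_filter, e.1, e.2] at hp
  simp at hp; omega

def WCp (k : ℕ) (p : Pr k) : Prop :=
  ¬ (candsS k (p.1 ∪ p.2)).Nonempty ∨ (umS k (p.1 ∪ p.2) ∈ p.1 ∧ umS k (p.1 ∪ p.2) ∈ p.2)

def wt (k : ℕ) (p : Pr k) : ℤ :=
  if mn k (p.1 ∪ p.2) ∉ p.1 then (if WCp k p then (-1) ^ (p.2.card - 1) else 0)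
  else (if WCp k p then (-1) ^ p.2.card * p.1.card
    else if umS k (p.1 ∪ p.2) ∈ p.1 then (-1) ^ p.2.card else 0)

def wt0 (k : ℕ) (p : Pr k) : ℤ :=
  if mn k (p.1 ∪ p.2) ∉ p.1 then (-1) ^ (p.2.card - 1)
  else (-1) ^ p.2.card * p.1.card

def tog {k : ℕ} (c : Idx k) (p : Pr k) : Pr k := (p.1.erase c, insert c p.2)
def tog' {k : ℕ} (c : Idx k) (p : Pr k) : Pr k := (insert c p.1, p.2.erase c)

lemma tog_union {k : ℕ} {c : Idx k} {p : Pr k} (h : c ∈ p.1) :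
    (tog c p).1 ∪ (tog c p).2 = p.1 ∪ p.2 := by
  ext x
  simp only [tog, Finset.mem_union, Finset.mem_erase, Finset.mem_insert]
  by_cases hx : x = c
  · subst hx; simp [h]
  · simp [hx]

lemma tog'_union {k : ℕ} {c : Idx k} {p : Pr k} (h : c ∈ p.2) :
    (tog' c p).1 ∪ (tog' c p).2 = p.1 ∪ p.2 := by
  ext x
  simp only [tog', Finset.mem_union, Finset.mem_erase, Finset.mem_insert]
  by_cases hx : x = c
  · subst hx; simp [h]
  · simp [hx]

lemma tog_tog' {k : ℕ} {c : Idx k} {p : Pr k} (h : c ∉ p.1) (h2 : c ∈ p.2) :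
    tog c (tog' c p) = p := by
  unfold tog tog'
  simp [Finset.erase_insert h, Finset.insert_erase h2]

lemma tog'_tog {k : ℕ} {c : Idx k} {p : Pr k} (h : c ∈ p.1) (h2 : c ∉ p.2) :
    tog' c (tog c p) = p := by
  unfold tog tog'
  simp [Finset.erase_insert h2, Finset.insert_erase h]

lemma toggle_sum {k : ℕ} {E : Type*} [AddCommGroup E] (c : Finset (Idx k) → Idx k) (r : ℕ)
    (Q Q' : Pr k → Prop)
    (hQ : ∀ p : Pr k, c (p.1 ∪ p.2) ∈ p.1 → c (p.1 ∪ p.2) ∉ p.2 →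
      (Q p ↔ Q' (tog (c (p.1 ∪ p.2)) p))) (F : Pr k → E) :
    ∑ p ∈ (Pairs k r).filter (fun p => Q p ∧ c (p.1 ∪ p.2) ∈ p.1 ∧ c (p.1 ∪ p.2) ∉ p.2),
      F (tog (c (p.1 ∪ p.2)) p) =
    ∑ p ∈ (Pairs k r).filter (fun p => Q' p ∧ c (p.1 ∪ p.2) ∉ p.1 ∧ c (p.1 ∪ p.2) ∈ p.2),
      F p := by
  refine Finset.sum_bij' (fun p _ => tog (c (p.1 ∪ p.2)) p) (fun p _ => tog' (c (p.1 ∪ p.2)) p)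
    ?_ ?_ ?_ ?_ ?_
  · intro p hp
    simp only [Finset.mem_filter, Pairs, Finset.mem_univ, true_and] at hp ⊢
    obtain ⟨h1, h2, h3, h4⟩ := hp
    rw [tog_union h3]
    refine ⟨?_, (hQ p h3 h4).1 h2, ?_, ?_⟩
    · simp only [tog]
      rw [Finset.card_erase_of_mem h3, Finset.card_insert_of_notMem h4]
      have := Finset.card_pos.2 ⟨_, h3⟩
      omega
    · simp [tog]
    · simp [tog]
  · intro p hp
    simp only [Finset.mem_filter, Pairs, Finset.mem_univ, true_and] at hp ⊢
    obtain ⟨h1, h2, h3, h4⟩ := hp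
    have hu := tog'_union (c := c (p.1 ∪ p.2)) h4
    have hm1 : c (p.1 ∪ p.2) ∈ (tog' (c (p.1 ∪ p.2)) p).1 := by simp [tog']
    have hm2 : c (p.1 ∪ p.2) ∉ (tog' (c (p.1 ∪ p.2)) p).2 := by simp [tog']
    refine ⟨?_, ?_, ?_, ?_⟩
    · simp only [tog']
      rw [Finset.card_erase_of_mem h4, Finset.card_insert_of_notMem h3]
      have := Finset.card_pos.2 ⟨_, h4⟩
      omega
    · rw [hQ _ (by rw [hu]; exact hm1) (by rw [hu]; exact hm2), hu, tog_tog' h3 h4]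
      exact h2
    · rw [hu]; exact hm1
    · rw [hu]; exact hm2
  · intro p hp
    simp only [Finset.mem_filter] at hp
    rw [tog_union hp.2.2.1, tog'_tog hp.2.2.1 hp.2.2.2]
  · intro p hp
    simp only [Finset.mem_filter] at hp
    rw [tog'_union hp.2.2.2, tog_tog' hp.2.2.1 hp.2.2.2]
  · intro p hp; rfl

section ident
variable {k : ℕ} {M E : Type*} [Monoid M] [AddCommGroup E] (a : Idx k → M)
  (hc : ∀ i j, NonAdj i j → Commute (a i) (a j)) (f : M → E)

lemma step1 (hc : ∀ i j, NonAdj i j → Commute (a i) (a j)) {r : ℕ} (hr : r ≤ k)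
    {p : Pr k} (hp : p ∈ Pairs k r) :
    ((dwordOf k p.1 ++ iwordOf k p.2).map a).prod = ((W k p).map a).prod := by
  have hS := Pairs_ne hr hp
  have hg := gap_notMem hS
  rw [Finset.mem_union, not_or] at hg
  have h1 : p.1 ≠ Finset.univ := by
    intro e; apply hS; rw [e]; simp
  have h2 : p.2 ≠ Finset.univ := by
    intro e; apply hS; rw [e]; simp
  rw [dwordOf_eq, iwordOf_eq, W]
  simp only [List.map_append, List.prod_append]
  rw [prod_dw a hc (gap_notMem h1) hg.1, prod_iw a hc (gap_notMem h2) hg.2]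

lemma tog_prod_mn {p : Pr k}
    (h1 : mn k (p.1 ∪ p.2) ∈ p.1) (h2 : mn k (p.1 ∪ p.2) ∉ p.2) :
    ((W k (tog (mn k (p.1 ∪ p.2)) p)).map a).prod = ((W k p).map a).prod := by
  unfold W
  rw [tog_union h1]
  unfold tog
  symm
  apply prod_toggle a h1 h2
  intro y hy hlt
  have := mn_le hy
  omega

lemma tog_prod_um (hc : ∀ i j, NonAdj i j → Commute (a i) (a j))
    {p : Pr k} (hS : p.1 ∪ p.2 ≠ Finset.univ)
    (hne : (candsS k (p.1 ∪ p.2)).Nonempty)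
    (h1 : umS k (p.1 ∪ p.2) ∈ p.1) (h2 : umS k (p.1 ∪ p.2) ∉ p.2) :
    ((W k (tog (umS k (p.1 ∪ p.2)) p)).map a).prod = ((W k p).map a).prod := by
  unfold W
  rw [tog_union h1]
  unfold tog
  symm
  apply prod_toggle a h1 h2
  intro y hy hlt
  exact hc _ _ (umS_nonadj hS hne hy hlt)

lemma step2 {r : ℕ} (hr1 : 1 ≤ r) :
    ∑ p ∈ Pairs k r, ((-1 : ℤ) ^ p.2.card * p.1.card) • f (((W k p).map a).prod) =
      ∑ p ∈ NPairs k r, wt0 k p • f (((W k p).map a).prod) := by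
  set φ : Pr k → E := fun p => f (((W k p).map a).prod) with hφ
  have ht := toggle_sum (k := k) (mn k) r (fun _ => True) (fun _ => True) (fun _ _ _ => Iff.rfl)
    (fun p => ((-1 : ℤ) ^ (p.2.card - 1) * (p.1.card + 1)) • φ p)
  simp only [true_and] at ht
  rw [← Finset.sum_filter_add_sum_filter_not (Pairs k r) (fun p => mn k (p.1 ∪ p.2) ∈ p.2)]
  have e1 : (Pairs k r).filter (fun p => ¬ mn k (p.1 ∪ p.2) ∈ p.2) =
      (Pairs k r).filter (fun p => mn k (p.1 ∪ p.2) ∈ p.1 ∧ mn k (p.1 ∪ p.2) ∉ p.2) := by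
    apply Finset.filter_congr
    intro p hp
    have := mn_mem (Pairs_nonempty hr1 hp)
    rw [Finset.mem_union] at this
    tauto
  have e2 : ∑ p ∈ (Pairs k r).filter (fun p => ¬ mn k (p.1 ∪ p.2) ∈ p.2),
      ((-1 : ℤ) ^ p.2.card * p.1.card) • φ p =
      ∑ p ∈ NPairs k r, if mn k (p.1 ∪ p.2) ∉ p.1 then
        ((-1 : ℤ) ^ (p.2.card - 1) * (p.1.card + 1)) • φ p else 0 := by
    rw [e1, ← Finset.sum_filter]
    have e3 : (NPairs k r).filter (fun p => mn k (p.1 ∪ p.2) ∉ p.1) =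
      (Pairs k r).filter (fun p => mn k (p.1 ∪ p.2) ∉ p.1 ∧ mn k (p.1 ∪ p.2) ∈ p.2) := by
      unfold NPairs
      rw [Finset.filter_filter]
      apply Finset.filter_congr
      intro p _; tauto
    rw [e3, ← ht]
    apply Finset.sum_congr rfl
    intro p hp
    rw [Finset.mem_filter] at hp
    obtain ⟨_, h1, h2⟩ := hp
    have h3 : φ (tog (mn k (p.1 ∪ p.2)) p) = φ p := by
      simp only [hφ]; rw [tog_prod_mn a h1 h2]
    rw [h3]
    congr 1
    simp only [tog]
    rw [Finset.card_erase_of_mem h1, Finset.card_insert_of_notMem h2]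
    have := Finset.card_pos.2 ⟨_, h1⟩
    rw [Nat.add_sub_cancel]
    congr 1
    rw [Nat.cast_sub (by omega)]; push_cast; ring
  rw [e2]
  change ∑ p ∈ NPairs k r, _ + _ = _
  rw [← Finset.sum_add_distrib]
  apply Finset.sum_congr rfl
  intro p hp
  unfold NPairs at hp
  rw [Finset.mem_filter] at hp
  have hpos := Finset.card_pos.2 ⟨_, hp.2⟩
  unfold wt0
  change _ • φ p + _ = _ • φ p
  split_ifs with h
  · rw [add_zero]
  · rw [← add_smul]
    congr 1
    obtain ⟨b, hb⟩ : ∃ b, p.2.card = b + 1 := ⟨p.2.card - 1, by omega⟩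
    rw [hb]; simp only [Nat.add_sub_cancel]; ring

lemma step3 (hc : ∀ i j, NonAdj i j → Commute (a i) (a j)) {r : ℕ} (hr1 : 1 ≤ r) (hr : r ≤ k) :
    ∑ p ∈ NPairs k r, wt0 k p • f (((W k p).map a).prod) =
      ∑ p ∈ NPairs k r, wt k p • f (((W k p).map a).prod) := by
  set φ : Pr k → E := fun p => f (((W k p).map a).prod) with hφ
  rw [← sub_eq_zero, ← Finset.sum_sub_distrib]
  simp only [← sub_smul]
  set d : Pr k → ℤ := fun p => wt0 k p - wt k p with hd
  change ∑ p ∈ NPairs k r, d p • φ p = 0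
  have hd0 : ∀ p, WCp k p → d p = 0 := by
    intro p hp
    simp only [hd, wt0, wt, hp, if_true, sub_self]
  set Q : Pr k → Prop := fun p => mn k (p.1 ∪ p.2) ∈ p.2 ∧ (candsS k (p.1 ∪ p.2)).Nonempty with hQ
  have ht := toggle_sum (k := k) (umS k) r Q Q ?_ (fun p => d p • φ p)
  swap
  · intro p h1 h2
    simp only [hQ]
    rw [tog_union h1]
    constructor
    · rintro ⟨h3, h4⟩
      exact ⟨by simp [tog, h3], h4⟩
    · rintro ⟨h3, h4⟩
      refine ⟨?_, h4⟩
      simp only [tog, Finset.mem_insert] at h3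
      rcases h3 with h3 | h3
      · exact absurd h3.symm (umS_ne_mn h4)
      · exact h3
  have hs : ∑ p ∈ NPairs k r, d p • φ p =
    ∑ p ∈ (Pairs k r).filter (fun p => Q p ∧ umS k (p.1 ∪ p.2) ∈ p.1 ∧ umS k (p.1 ∪ p.2) ∉ p.2),
      d p • φ p +
    ∑ p ∈ (Pairs k r).filter (fun p => Q p ∧ umS k (p.1 ∪ p.2) ∉ p.1 ∧ umS k (p.1 ∪ p.2) ∈ p.2),
      d p • φ p := by
    rw [← Finset.sum_union]
    · symm
      apply Finset.sum_subset
      · intro p hp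
        rw [Finset.mem_union, Finset.mem_filter, Finset.mem_filter] at hp
        unfold NPairs
        rw [Finset.mem_filter]
        rcases hp with hp | hp
        · exact ⟨hp.1, hp.2.1.1⟩
        · exact ⟨hp.1, hp.2.1.1⟩
      · intro p hp hnp
        rw [hd0, zero_smul]
        unfold NPairs at hp
        rw [Finset.mem_filter] at hp
        rw [Finset.mem_union, Finset.mem_filter, Finset.mem_filter, not_or] at hnp
        unfold WCp
        by_cases hne : (candsS k (p.1 ∪ p.2)).Nonempty
        · right
          have hm := umS_mem hne
          unfold candsS at hm
          rw [Finset.mem_filter, Finset.mem_union] at hm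
          by_cases hA : umS k (p.1 ∪ p.2) ∈ p.1
          · by_cases hB : umS k (p.1 ∪ p.2) ∈ p.2
            · exact ⟨hA, hB⟩
            · exact absurd ⟨hp.1, ⟨hp.2, hne⟩, hA, hB⟩ hnp.1
          · by_cases hB : umS k (p.1 ∪ p.2) ∈ p.2
            · exact absurd ⟨hp.1, ⟨hp.2, hne⟩, hA, hB⟩ hnp.2
            · exact absurd hm.1 (not_or.2 ⟨hA, hB⟩)
        · left; exact hne
    · rw [Finset.disjoint_left]
      intro p h1 h2
      rw [Finset.mem_filter] at h1 h2
      exact h2.2.2.1 h1.2.2.1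
  have ht2 : ∑ p ∈ (Pairs k r).filter
      (fun p => Q p ∧ umS k (p.1 ∪ p.2) ∉ p.1 ∧ umS k (p.1 ∪ p.2) ∈ p.2), d p • φ p =
      ∑ p ∈ (Pairs k r).filter
        (fun p => Q p ∧ umS k (p.1 ∪ p.2) ∈ p.1 ∧ umS k (p.1 ∪ p.2) ∉ p.2),
      d (tog (umS k (p.1 ∪ p.2)) p) • φ (tog (umS k (p.1 ∪ p.2)) p) := by
    convert ht.symm
  rw [hs, ht2, ← Finset.sum_add_distrib]
  apply Finset.sum_eq_zero
  intro p hp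
  rw [Finset.mem_filter] at hp
  obtain ⟨hP, ⟨hq1, hq2⟩, h1, h2⟩ := hp
  have h3 : φ (tog (umS k (p.1 ∪ p.2)) p) = φ p := by
    simp only [hφ]; rw [tog_prod_um a hc (Pairs_ne hr hP) hq2 h1 h2]
  rw [h3, ← add_smul]
  have hne := umS_ne_mn hq2
  have : d p + d (tog (umS k (p.1 ∪ p.2)) p) = 0 := by
    simp only [hd]
    have w1 : ¬ WCp k p := by
      unfold WCp
      rintro (h | h)
      · exact h hq2
      · exact h2 h.2
    have w2 : ¬ WCp k (tog (umS k (p.1 ∪ p.2)) p) := by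
      unfold WCp
      rw [tog_union h1]
      simp [tog, hq2]
    unfold wt0 wt
    rw [tog_union h1]
    simp only [w1, w2, if_false]
    have hpos := Finset.card_pos.2 ⟨_, hq1⟩
    have hpos1 := Finset.card_pos.2 ⟨_, h1⟩
    obtain ⟨b, hb⟩ : ∃ b, p.2.card = b + 1 := ⟨p.2.card - 1, by omega⟩
    obtain ⟨b', hb'⟩ : ∃ b, p.1.card = b + 1 := ⟨p.1.card - 1, by omega⟩
    have m1 : mn k (p.1 ∪ p.2) ∈ (tog (umS k (p.1 ∪ p.2)) p).1 ↔ mn k (p.1 ∪ p.2) ∈ p.1 := by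
      simp [tog, hne.symm]
    have m2 : umS k (p.1 ∪ p.2) ∉ (tog (umS k (p.1 ∪ p.2)) p).1 := by simp [tog]
    have c1 : (tog (umS k (p.1 ∪ p.2)) p).1.card = b' := by
      simp only [tog]; rw [Finset.card_erase_of_mem h1]; omega
    have c2 : (tog (umS k (p.1 ∪ p.2)) p).2.card = b + 2 := by
      simp only [tog]; rw [Finset.card_insert_of_notMem h2]; omega
    rw [c1, c2]
    simp only [m1, m2, h1, hb, hb', if_true, if_false]
    split_ifs
    · simp; ring
    · push_cast; ring
  rw [this, zero_smul]

theorem main_identity (hc : ∀ i j, NonAdj i j → Commute (a i) (a j)) {r : ℕ}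
    (hr1 : 1 ≤ r) (hr : r ≤ k) :
    ∑ p ∈ Pairs k r, ((-1 : ℤ) ^ p.2.card * p.1.card) •
        f (((dwordOf k p.1 ++ iwordOf k p.2).map a).prod) =
      ∑ p ∈ NPairs k r, wt k p • f (((W k p).map a).prod) := by
  rw [← step3 a f hc hr1 hr, ← step2 a f hr1]
  apply Finset.sum_congr rfl
  intro p hp
  rw [step1 a hc hr hp]

end ident

/-! # Part C: hook words and pairs -/

def cnt (l : List ℕ) : ℕ := (l.zip l.tail).countP fun p => decide (p.1 < p.2)

lemma cnt_cons (x y : ℕ) (t : List ℕ) :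
    cnt (x :: y :: t) = cnt (y :: t) + if x < y then 1 else 0 := by
  simp [cnt, List.countP_cons]

lemma cnt_inc (E : List ℕ) : ∀ v, (v :: E).Pairwise (· < ·) → cnt (v :: E) = E.length := by
  induction E with
  | nil => intro v _; rfl
  | cons x t ih =>
    intro v h
    rw [List.pairwise_cons] at h
    rw [cnt_cons, ih x h.2, if_pos (h.1 x (by simp))]
    simp

lemma cnt_hook (v : ℕ) (E : List ℕ) (hE : (v :: E).Pairwise (· < ·)) :
    ∀ D : List ℕ, (D ++ [v]).Pairwise (· ≥ ·) → cnt (D ++ v :: E) = E.length := by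
  intro D
  induction D with
  | nil => intro _; exact cnt_inc E v hE
  | cons x t ih =>
    intro h
    rw [List.cons_append, List.pairwise_cons] at h
    cases t with
    | nil =>
      have := h.1 v (by simp)
      change cnt (x :: v :: E) = _
      rw [cnt_cons, if_neg (by omega), ← ih h.2]; rfl
    | cons y s =>
      have := h.1 y (by simp)
      change cnt (x :: y :: (s ++ v :: E)) = _
      rw [cnt_cons, if_neg (by omega), ← ih h.2]; rfl

lemma mem_NPairs {k r : ℕ} {p : Pr k} :
    p ∈ NPairs k r ↔ p.1.card + p.2.card = r ∧ mn k (p.1 ∪ p.2) ∈ p.2 := by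
  simp [NPairs, Pairs]

/-- the normal form of W -/
lemma W_norm {k : ℕ} {p : Pr k} (h : mn k (p.1 ∪ p.2) ∈ p.2) :
    iw k (gap k (p.1 ∪ p.2)) p.2 =
      mn k (p.1 ∪ p.2) :: iw k (gap k (p.1 ∪ p.2)) (p.2.erase (mn k (p.1 ∪ p.2))) :=
  iw_min h (fun y hy => mn_le (Finset.mem_union_right _ hy))

lemma posList_W (k : ℕ) (p : Pr k) :
    posList k (W k p) = (dw k (gap k (p.1 ∪ p.2)) p.1).map (pg k (gap k (p.1 ∪ p.2))) ++
      (iw k (gap k (p.1 ∪ p.2)) p.2).map (pg k (gap k (p.1 ∪ p.2))) := by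
  unfold posList
  rw [supp_W, W, List.map_append]; rfl

lemma asc_W {k : ℕ} {p : Pr k} (h : mn k (p.1 ∪ p.2) ∈ p.2) :
    asc k (W k p) = p.2.card - 1 := by
  change cnt (posList k (W k p)) = _
  rw [posList_W, W_norm h, List.map_cons, cnt_hook]
  · rw [List.length_map, iw_length, Finset.card_erase_of_mem h]
  · rw [← List.map_cons, ← W_norm h, List.pairwise_map]
    exact iw_pairwise _ _ _
  · rw [List.pairwise_append]
    refine ⟨?_, by simp, ?_⟩
    · rw [List.pairwise_map]
      exact (dw_pairwise _ _ _).imp (fun h => le_of_lt h)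
    · intro a ha b hb
      rw [List.mem_singleton] at hb
      subst hb
      rw [List.mem_map] at ha
      obtain ⟨y, hy, rfl⟩ := ha
      rw [mem_dw] at hy
      exact mn_le (Finset.mem_union_left _ hy)

lemma W_inj {k r : ℕ} : Set.InjOn (W k) (NPairs k r : Set (Pr k)) := by
  intro p hp q hq h
  rw [Finset.mem_coe, mem_NPairs] at hp hq
  have hs : p.1 ∪ p.2 = q.1 ∪ q.2 := by rw [← supp_W, ← supp_W, h]
  have ha : p.2.card - 1 = q.2.card - 1 := by rw [← asc_W hp.2, ← asc_W hq.2, h]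
  have h1 := Finset.card_pos.2 ⟨_, hp.2⟩
  have h2 := Finset.card_pos.2 ⟨_, hq.2⟩
  unfold W at h
  rw [hs] at h
  obtain ⟨e1, e2⟩ := List.append_inj h (by rw [dw_length, dw_length]; omega)
  have e1' := congrArg List.toFinset e1
  have e2' := congrArg List.toFinset e2
  rw [dw_toFinset, dw_toFinset] at e1'
  rw [iw_toFinset, iw_toFinset] at e2'
  exact Prod.ext e1' e2'

lemma mn_unique {k : ℕ} {S : Finset (Idx k)} {v : Idx k} (hv : v ∈ S)
    (h : ∀ y ∈ S, pg k (gap k S) v ≤ pg k (gap k S) y) : mn k S = v := by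
  have h1 := mn_le hv
  have h2 := h _ (mn_mem ⟨v, hv⟩)
  exact pg_inj k _ (le_antisymm h1 h2)

/-- from lists to pairs -/
lemma W_of_lists {k : ℕ} {u D : Word k} {v : Idx k} {F : Word k}
    (hu : u = D ++ v :: F)
    (hD : D.Pairwise (fun x y => pg k (gap k (supp k u)) y < pg k (gap k (supp k u)) x))
    (hF : (v :: F).Pairwise (fun x y => pg k (gap k (supp k u)) x < pg k (gap k (supp k u)) y))
    (hDv : ∀ y ∈ D, pg k (gap k (supp k u)) v ≤ pg k (gap k (supp k u)) y) :
    (D.toFinset, (v :: F).toFinset) ∈ NPairs k u.length ∧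
      W k (D.toFinset, (v :: F).toFinset) = u ∧
      mn k (D.toFinset ∪ (v :: F).toFinset) = v := by
  have hs : D.toFinset ∪ (v :: F).toFinset = supp k u := by
    rw [hu]; unfold supp; rw [List.toFinset_append]
  have hv : v ∈ supp k u := by rw [← hs]; simp
  have hmn : mn k (supp k u) = v := by
    apply mn_unique hv
    intro y hy
    rw [← hs, Finset.mem_union, List.mem_toFinset, List.mem_toFinset, List.mem_cons] at hy
    rcases hy with hy | rfl | hy
    · exact hDv y hy
    · exact le_rfl
    · rw [List.pairwise_cons] at hF
      exact le_of_lt (hF.1 y hy)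
  have nD : D.Nodup := hD.imp (by intro a b h e; subst e; omega)
  have nF : (v :: F).Nodup := hF.imp (by intro a b h e; subst e; omega)
  refine ⟨?_, ?_, by rw [hs, hmn]⟩
  · rw [mem_NPairs]
    simp only
    rw [hs, hmn, List.toFinset_card_of_nodup nD, List.toFinset_card_of_nodup nF]
    refine ⟨?_, by simp⟩
    rw [hu, List.length_append]
  · unfold W
    simp only
    rw [hs, ← dw_unique hD (by intro x; rw [List.mem_toFinset]),
      ← iw_unique hF (by intro x; rw [List.mem_toFinset]), ← hu]

lemma hookV_pair {k r : ℕ} {u : Word k} (hu : IsHookV k u) (hl : u.length = r) :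
    ∃ p ∈ NPairs k r, W k p = u ∧ mn k (p.1 ∪ p.2) ∉ p.1 := by
  subst hl
  obtain ⟨-, ds, as, v, hpl, hd, ha⟩ := hu
  have hd' := List.isChain_iff_pairwise.1 hd
  have ha' := List.isChain_iff_pairwise.1 ha
  unfold posList at hpl
  rw [List.map_eq_append_iff] at hpl
  obtain ⟨D, F', hu, rfl, hF'⟩ := hpl
  rw [List.map_eq_cons_iff] at hF'
  obtain ⟨x, F, rfl, rfl, rfl⟩ := hF'
  rw [← List.map_cons, List.pairwise_map] at ha'
  rw [List.pairwise_append, List.pairwise_map] at hd'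
  obtain ⟨hd1, -, hd2⟩ := hd'
  have hd3 : ∀ y ∈ D, pos k (supp k u) x < pos k (supp k u) y := by
    intro y hy
    exact hd2 _ (List.mem_map_of_mem hy) _ (by simp)
  obtain ⟨h1, h2, h3⟩ := W_of_lists hu hd1 ha' (fun y hy => le_of_lt (hd3 y hy))
  refine ⟨_, h1, h2, ?_⟩
  simp only
  rw [h3, List.mem_toFinset]
  intro hx
  exact lt_irrefl _ (hd3 x hx)

lemma hookU_pair {k r : ℕ} {u : Word k} (hu : IsHookU k u) (hl : u.length = r) :
    ∃ p ∈ NPairs k r, W k p = u ∧ mn k (p.1 ∪ p.2) ∈ p.1 := by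
  subst hl
  obtain ⟨-, ds, as, v, hpl, hd, ha⟩ := hu
  have hd' := List.isChain_iff_pairwise.1 hd
  have ha' := List.isChain_iff_pairwise.1 ha
  unfold posList at hpl
  rw [List.map_eq_append_iff] at hpl
  obtain ⟨D, F', hu, rfl, hF'⟩ := hpl
  rw [List.map_eq_cons_iff] at hF'
  obtain ⟨x, F'', rfl, rfl, hF''⟩ := hF'
  rw [List.map_eq_cons_iff] at hF''
  obtain ⟨x', F, rfl, hx, rfl⟩ := hF''
  have hxx : x' = x := pg_inj k _ hx
  subst hxx
  rw [← List.map_cons, List.pairwise_map] at ha'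
  have e : List.map (pos k (supp k u)) D ++ [pos k (supp k u) x'] =
      (D ++ [x']).map (pos k (supp k u)) := by simp
  rw [e, List.pairwise_map] at hd'
  have hu' : u = (D ++ [x']) ++ x' :: F := by rw [hu]; simp
  obtain ⟨h1, h2, h3⟩ := W_of_lists hu' hd' ha' (by
    intro y hy
    rw [List.mem_append, List.mem_singleton] at hy
    rcases hy with hy | rfl
    · rw [List.pairwise_append] at hd'
      exact le_of_lt (hd'.2.2 y hy x' (by simp))
    · exact le_rfl)
  refine ⟨_, h1, h2, ?_⟩
  simp only
  rw [h3, List.mem_toFinset]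
  simp

lemma pair_hookV {k r : ℕ} (hr : r ≤ k) {p : Pr k} (hp : p ∈ NPairs k r)
    (h : mn k (p.1 ∪ p.2) ∉ p.1) : IsHookV k (W k p) := by
  have hpp := Finset.mem_of_mem_filter _ hp
  rw [mem_NPairs] at hp
  refine ⟨by rw [supp_W]; exact Pairs_ne hr hpp, ?_⟩
  rw [posList_W, W_norm hp.2, List.map_cons]
  refine ⟨_, _, _, rfl, ?_, ?_⟩
  · refine List.isChain_iff_pairwise.2 ?_
    rw [List.pairwise_append]
    refine ⟨?_, by simp, ?_⟩
    · rw [List.pairwise_map]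
      exact (dw_pairwise _ _ _)
    · intro a ha b hb
      rw [List.mem_singleton] at hb
      subst hb
      rw [List.mem_map] at ha
      obtain ⟨y, hy, rfl⟩ := ha
      rw [mem_dw] at hy
      refine lt_of_le_of_ne (mn_le (Finset.mem_union_left _ hy)) ?_
      intro e
      exact h (by rw [pg_inj k _ e]; exact hy)
  · refine List.isChain_iff_pairwise.2 ?_
    rw [← List.map_cons, ← W_norm hp.2, List.pairwise_map]
    exact iw_pairwise _ _ _

lemma pair_hookU {k r : ℕ} (hr : r ≤ k) {p : Pr k} (hp : p ∈ NPairs k r)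
    (h : mn k (p.1 ∪ p.2) ∈ p.1) : IsHookU k (W k p) := by
  have hpp := Finset.mem_of_mem_filter _ hp
  rw [mem_NPairs] at hp
  refine ⟨by rw [supp_W]; exact Pairs_ne hr hpp, ?_⟩
  have e := dw_min h (fun y hy => mn_le (Finset.mem_union_left p.2 hy))
  refine ⟨(dw k (gap k (p.1 ∪ p.2)) (p.1.erase (mn k (p.1 ∪ p.2)))).map
    (pg k (gap k (p.1 ∪ p.2))),
    (iw k (gap k (p.1 ∪ p.2)) (p.2.erase (mn k (p.1 ∪ p.2)))).map (pg k (gap k (p.1 ∪ p.2))),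
    pg k (gap k (p.1 ∪ p.2)) (mn k (p.1 ∪ p.2)), ?_, ?_, ?_⟩
  · rw [posList_W, W_norm hp.2, e]
    simp
  · refine List.isChain_iff_pairwise.2 ?_
    have e2 := congrArg (List.map (pg k (gap k (p.1 ∪ p.2)))) e
    rw [List.map_append, List.map_singleton] at e2
    rw [← e2, List.pairwise_map]
    exact dw_pairwise _ _ _
  · refine List.isChain_iff_pairwise.2 ?_
    rw [← List.map_cons, ← W_norm hp.2, List.pairwise_map]
    exact iw_pairwise _ _ _

lemma wc_W {k : ℕ} (p : Pr k) : IsWeakConnected k (W k p) ↔ WCp k p := by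
  unfold IsWeakConnected uminCount WCp
  rw [uminCands_eq, umin_eq, supp_W]
  by_cases hne : (candsS k (p.1 ∪ p.2)).Nonempty
  · have hm := umS_mem hne
    unfold candsS at hm
    rw [Finset.mem_filter, Finset.mem_union] at hm
    have hm := hm.1
    rw [if_pos hne]
    unfold W
    rw [List.count_append]
    have c1 : (dw k (gap k (p.1 ∪ p.2)) p.1).count (umS k (p.1 ∪ p.2)) =
        if umS k (p.1 ∪ p.2) ∈ p.1 then 1 else 0 := by
      rw [(dw_nodup _ _ _).count]; simp only [mem_dw]
    have c2 : (iw k (gap k (p.1 ∪ p.2)) p.2).count (umS k (p.1 ∪ p.2)) =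
        if umS k (p.1 ∪ p.2) ∈ p.2 then 1 else 0 := by
      rw [(iw_nodup _ _ _).count]; simp only [mem_iw]
    rw [c1, c2]
    by_cases h1 : umS k (p.1 ∪ p.2) ∈ p.1 <;> by_cases h2 : umS k (p.1 ∪ p.2) ∈ p.2 <;>
      simp [h1, h2, hne] <;> tauto
  · simp [hne]

lemma left_W {k : ℕ} {p : Pr k} (h : mn k (p.1 ∪ p.2) ∈ p.2) (hw : ¬ WCp k p) :
    OnLeftSide k (W k p) (umin k (W k p)) ↔ umS k (p.1 ∪ p.2) ∈ p.1 := by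
  unfold OnLeftSide
  rw [umin_eq, supp_W]
  unfold WCp at hw
  rw [not_or, not_not] at hw
  obtain ⟨hne, hw⟩ := hw
  constructor
  · rintro ⟨x, y, hxy, hch, hm⟩
    by_contra hA
    have hch' := List.isChain_iff_pairwise (R := fun a b => pg k (gap k (p.1 ∪ p.2)) b <
      pg k (gap k (p.1 ∪ p.2)) a) |>.1 hch
    unfold W at hxy
    rw [List.append_eq_append_iff] at hxy
    rcases hxy with ⟨z, rfl, hz⟩ | ⟨z, hz, rfl⟩
    · rw [List.mem_append, mem_dw] at hm
      have hmz := hm.resolve_left hA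
      have pz : z.Pairwise (fun a b => pg k (gap k (p.1 ∪ p.2)) a <
          pg k (gap k (p.1 ∪ p.2)) b) :=
        (iw_pairwise k (gap k (p.1 ∪ p.2)) p.2).sublist (by rw [hz]; simp)
      have pz2 := (List.pairwise_append.1 hch').2.1
      rw [W_norm h] at hz
      cases z with
      | nil => simp at hmz
      | cons a t =>
        cases t with
        | nil =>
          rw [List.mem_singleton] at hmz
          rw [List.cons_append, List.cons.injEq] at hz
          exact umS_ne_mn hne (by rw [hmz, hz.1])
        | cons b s =>
          have q1 := (List.pairwise_cons.1 pz).1 b (by simp)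
          have q2 := (List.pairwise_cons.1 pz2).1 b (by simp)
          omega
    · apply hA
      rw [← mem_dw (g := gap k (p.1 ∪ p.2)), hz]
      simp [hm]
  · intro hA
    refine ⟨_, _, rfl, ?_, mem_dw.2 hA⟩
    exact List.isChain_iff_pairwise (R := fun a b => pg k (gap k (p.1 ∪ p.2)) b <
      pg k (gap k (p.1 ∪ p.2)) a) |>.2 (dw_pairwise _ _ _)

lemma ncard_W {k r : ℕ} (X : Set (Word k)) (T : Finset (Pr k)) (hT : T ⊆ NPairs k r)
    (h1 : ∀ p ∈ T, W k p ∈ X) (h2 : ∀ u ∈ X, ∃ p ∈ T, W k p = u) :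
    X.ncard = T.card := by
  have e : X = W k '' (T : Set (Pr k)) := by
    ext u
    constructor
    · intro hu
      obtain ⟨p, hp, rfl⟩ := h2 u hu
      exact ⟨p, hp, rfl⟩
    · rintro ⟨p, hp, rfl⟩
      exact h1 p hp
  rw [e, Set.ncard_image_of_injOn (W_inj.mono (by exact_mod_cast hT)), Set.ncard_coe_finset]

lemma ncard_VWC {k r : ℕ} (hr : r ≤ k) (P : Word k → Prop) (i : ℤ) :
    {u ∈ VSetWC k r i | P u}.ncard = ((NPairs k r).filter (fun p =>
      (mn k (p.1 ∪ p.2) ∉ p.1 ∧ WCp k p ∧ P (W k p)) ∧ ((p.2.card - 1 : ℕ) : ℤ) = i)).card := by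
  refine ncard_W (r := r) _ _ (Finset.filter_subset _ _) ?_ ?_
  · intro p hp
    rw [Finset.mem_filter] at hp
    obtain ⟨hp, ⟨h1, h2, h3⟩, h4⟩ := hp
    have hq := mem_NPairs.1 hp
    exact ⟨⟨⟨pair_hookV hr hp h1, by rw [length_W, hq.1], by rw [asc_W hq.2, h4]⟩,
      (wc_W p).2 h2⟩, h3⟩
  · rintro u ⟨⟨⟨hV, hl, ha⟩, hw⟩, hP⟩
    obtain ⟨p, hp, rfl, hm⟩ := hookV_pair hV hl
    have hq := mem_NPairs.1 hp
    refine ⟨p, ?_, rfl⟩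
    rw [Finset.mem_filter]
    exact ⟨hp, ⟨hm, (wc_W p).1 hw, hP⟩, by rw [← ha, asc_W hq.2]⟩

lemma ncard_UWC {k r : ℕ} (hr : r ≤ k) (P : Word k → Prop) (i : ℤ) :
    {u ∈ USetWC k r (i - 1) | P u}.ncard = ((NPairs k r).filter (fun p =>
      (mn k (p.1 ∪ p.2) ∈ p.1 ∧ WCp k p ∧ P (W k p)) ∧ (p.2.card : ℤ) = i)).card := by
  refine ncard_W (r := r) _ _ (Finset.filter_subset _ _) ?_ ?_
  · intro p hp
    rw [Finset.mem_filter] at hp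
    obtain ⟨hp, ⟨h1, h2, h3⟩, h4⟩ := hp
    have hq := mem_NPairs.1 hp
    have := Finset.card_pos.2 ⟨_, hq.2⟩
    exact ⟨⟨⟨pair_hookU hr hp h1, by rw [length_W, hq.1], by rw [asc_W hq.2]; omega⟩,
      (wc_W p).2 h2⟩, h3⟩
  · rintro u ⟨⟨⟨hV, hl, ha⟩, hw⟩, hP⟩
    obtain ⟨p, hp, rfl, hm⟩ := hookU_pair hV hl
    have hq := mem_NPairs.1 hp
    have := Finset.card_pos.2 ⟨_, hq.2⟩
    refine ⟨p, ?_, rfl⟩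
    rw [Finset.mem_filter]
    rw [asc_W hq.2] at ha
    exact ⟨hp, ⟨hm, (wc_W p).1 hw, hP⟩, by omega⟩

lemma ncard_UL {k r : ℕ} (hr : r ≤ k) (P : Word k → Prop) (i : ℤ) :
    {u ∈ USetNWCL k r (i - 1) | P u}.ncard = ((NPairs k r).filter (fun p =>
      (mn k (p.1 ∪ p.2) ∈ p.1 ∧ (¬ WCp k p ∧ umS k (p.1 ∪ p.2) ∈ p.1) ∧ P (W k p)) ∧
        (p.2.card : ℤ) = i)).card := by
  refine ncard_W (r := r) _ _ (Finset.filter_subset _ _) ?_ ?_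
  · intro p hp
    rw [Finset.mem_filter] at hp
    obtain ⟨hp, ⟨h1, ⟨h2, h2'⟩, h3⟩, h4⟩ := hp
    have hq := mem_NPairs.1 hp
    have := Finset.card_pos.2 ⟨_, hq.2⟩
    exact ⟨⟨⟨pair_hookU hr hp h1, by rw [length_W, hq.1], by rw [asc_W hq.2]; omega⟩,
      fun h => h2 ((wc_W p).1 h), (left_W hq.2 h2).2 h2'⟩, h3⟩
  · rintro u ⟨⟨⟨hV, hl, ha⟩, hw, hL⟩, hP⟩
    obtain ⟨p, hp, rfl, hm⟩ := hookU_pair hV hl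
    have hq := mem_NPairs.1 hp
    have := Finset.card_pos.2 ⟨_, hq.2⟩
    have hw' : ¬ WCp k p := fun h => hw ((wc_W p).2 h)
    refine ⟨p, ?_, rfl⟩
    rw [Finset.mem_filter]
    rw [asc_W hq.2] at ha
    exact ⟨hp, ⟨hm, ⟨hw', (left_W hq.2 hw').1 hL⟩, hP⟩, by omega⟩

lemma fiber_sum {α : Type*} (T : Finset α) (I : Finset ℕ) (q : α → Prop) [DecidablePred q] (n : α → ℕ)
    (hn : ∀ p ∈ T, q p → n p ∈ I) (c : ℕ → ℤ) :
    ∑ i ∈ I, c i * ((T.filter (fun p => q p ∧ ((n p : ℕ) : ℤ) = (i : ℤ))).card : ℤ) =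
      ∑ p ∈ T, if q p then c (n p) else 0 := by
  rw [← Finset.sum_filter,
    ← Finset.sum_fiberwise_of_maps_to (s := T.filter q) (t := I) (g := n)
      (fun p hp => hn p (Finset.mem_filter.1 hp).1 (Finset.mem_filter.1 hp).2)]
  apply Finset.sum_congr rfl
  intro i _
  rw [Finset.filter_filter]
  have : T.filter (fun p => q p ∧ ((n p : ℕ) : ℤ) = (i : ℤ)) =
      T.filter (fun p => q p ∧ n p = i) := by
    apply Finset.filter_congr; intro p _; rw [Nat.cast_inj]
  rw [this, Finset.sum_congr rfl (g := fun _ => c i)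
    (fun p hp => by rw [(Finset.mem_filter.1 hp).2.2]), Finset.sum_const, nsmul_eq_mul, mul_comm]

theorem MNcoeff_eq {k r : ℕ} (hr : r ≤ k) (P : Word k → Prop) :
    MNcoeff k r P = ∑ p ∈ NPairs k r, if P (W k p) then wt k p else 0 := by
  unfold MNcoeff
  simp only [ncard_VWC hr, ncard_UWC hr, ncard_UL hr]
  rw [fiber_sum (NPairs k r) (Finset.range r)
    (fun p => mn k (p.1 ∪ p.2) ∉ p.1 ∧ WCp k p ∧ P (W k p)) (fun p => p.2.card - 1) ?_
      (fun i => (-1 : ℤ) ^ i),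
    fiber_sum (NPairs k r) (Finset.Icc 1 (r - 1))
    (fun p => mn k (p.1 ∪ p.2) ∈ p.1 ∧ WCp k p ∧ P (W k p)) (fun p => p.2.card) ?_
      (fun i => (-1 : ℤ) ^ i * ((r : ℤ) - i)),
    fiber_sum (NPairs k r) (Finset.Icc 1 (r - 2))
    (fun p => mn k (p.1 ∪ p.2) ∈ p.1 ∧ (¬ WCp k p ∧ umS k (p.1 ∪ p.2) ∈ p.1) ∧ P (W k p))
      (fun p => p.2.card) ?_ (fun i => (-1 : ℤ) ^ i)]
  · rw [← Finset.sum_add_distrib, ← Finset.sum_add_distrib]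
    apply Finset.sum_congr rfl
    intro p hp
    have hq := mem_NPairs.1 hp
    have e : (r : ℤ) - p.2.card = p.1.card := by rw [← hq.1]; push_cast; ring
    rw [e]
    unfold wt
    by_cases h1 : P (W k p) <;> by_cases h2 : mn k (p.1 ∪ p.2) ∈ p.1 <;> by_cases h3 : WCp k p <;>
      simp [h1, h2, h3]
  · intro p hp ⟨h1, h2, h3⟩
    have hq := mem_NPairs.1 hp
    have a1 := Finset.card_pos.2 ⟨_, hq.2⟩
    have a2 : 1 < p.1.card := by
      rw [Finset.one_lt_card]
      refine ⟨_, h2.2, _, h1, umS_ne_mn ?_⟩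
      have := h2.1
      unfold WCp at this
      rw [not_or, not_not] at this
      exact this.1
    rw [Finset.mem_Icc]; omega
  · intro p hp ⟨h1, h2, h3⟩
    have hq := mem_NPairs.1 hp
    have a1 := Finset.card_pos.2 ⟨_, hq.2⟩
    have a2 := Finset.card_pos.2 ⟨_, h1⟩
    rw [Finset.mem_Icc]; omega
  · intro p hp ⟨h1, h2, h3⟩
    have hq := mem_NPairs.1 hp
    have a1 := Finset.card_pos.2 ⟨_, hq.2⟩
    simp only [Finset.mem_range]; omega

/-! ### Young diagrams, beta numbers and cores -/

def rl (S : Set Cell) (i : ℕ) : ℕ := {j | (i, j) ∈ S}.ncard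

def bt (S : Set Cell) (i : ℕ) : ℤ := (rl S i : ℤ) - i

lemma lower_nat {T : Set ℕ} (hf : T.Finite) (hl : ∀ a ∈ T, ∀ b ≤ a, b ∈ T) :
    T = Set.Iio T.ncard := by
  obtain ⟨n, hn⟩ : ∃ n, T = Set.Iio n := by
    have hex : ∃ n, n ∉ T := by
      by_contra hcon
      push Not at hcon
      exact Set.infinite_univ (hf.subset (fun x _ => hcon x))
    refine ⟨Nat.find hex, ?_⟩
    ext x
    rw [Set.mem_Iio, Nat.lt_find_iff]
    constructor
    · intro hx m hm
      rw [not_not]; exact hl x hx m hm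
    · intro h
      have := h x le_rfl
      rwa [not_not] at this
  have : T.ncard = n := by
    rw [hn, ← Finset.coe_Iio, Set.ncard_coe_finset, Nat.card_Iio]
  rw [this]; exact hn

lemma row_finite {S : Set Cell} (hS : S.Finite) (i : ℕ) : {j | (i, j) ∈ S}.Finite := by
  apply (hS.image Prod.snd).subset
  intro j hj
  exact ⟨(i, j), hj, rfl⟩

lemma mem_iff_rl {S : Set Cell} (hS : IsYoung S) (i j : ℕ) : (i, j) ∈ S ↔ j < rl S i := by
  have := lower_nat (row_finite hS.1 i) (fun a ha b hb => hS.2 (i, a) ha (i, b) le_rfl hb)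
  change j ∈ {j | (i, j) ∈ S} ↔ _
  rw [this]; rfl

lemma rl_anti {S : Set Cell} (hS : IsYoung S) {i j : ℕ} (h : i ≤ j) : rl S j ≤ rl S i := by
  by_contra hcon
  push Not at hcon
  have h1 := (mem_iff_rl hS j (rl S i)).2 hcon
  have h2 := hS.2 _ h1 (i, rl S i) h le_rfl
  rw [mem_iff_rl hS] at h2
  omega

lemma rl_ev {S : Set Cell} (hS : IsYoung S) : ∃ N, ∀ i, N ≤ i → rl S i = 0 := by
  obtain ⟨N, hN⟩ := (hS.1.image Prod.fst).bddAbove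
  refine ⟨N + 1, fun i hi => ?_⟩
  by_contra hcon
  have h1 := (mem_iff_rl hS i 0).2 (Nat.pos_of_ne_zero hcon)
  have h2 : i ≤ N := hN ⟨(i, 0), h1, rfl⟩
  omega

lemma young_ext {S T : Set Cell} (hS : IsYoung S) (hT : IsYoung T) (h : ∀ i, rl S i = rl T i) :
    S = T := by
  ext ⟨i, j⟩
  rw [mem_iff_rl hS, mem_iff_rl hT, h]

lemma rl_fun (f : ℕ → ℕ) (i : ℕ) : rl {c : Cell | c.2 < f c.1} i = f i := by
  unfold rl
  have : {j | (i, j) ∈ {c : Cell | c.2 < f c.1}} = Set.Iio (f i) := by ext; simp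
  rw [this, ← Finset.coe_Iio, Set.ncard_coe_finset, Nat.card_Iio]

lemma young_fun {f : ℕ → ℕ} (hf : ∀ i j, i ≤ j → f j ≤ f i) {N : ℕ} (hN : ∀ i, N ≤ i → f i = 0) :
    IsYoung {c : Cell | c.2 < f c.1} := by
  refine ⟨?_, ?_⟩
  · apply ((Set.finite_Iio N).prod (Set.finite_Iio (f 0))).subset
    rintro ⟨i, j⟩ h
    simp only [Set.mem_setOf_eq] at h
    refine ⟨?_, ?_⟩
    · by_contra hcon
      have := hN i (by simpa using hcon)
      omega
    · exact lt_of_lt_of_le h (hf 0 i (Nat.zero_le _))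
  · rintro ⟨i, j⟩ h ⟨i', j'⟩ h1 h2
    simp only [Set.mem_setOf_eq] at *
    exact lt_of_le_of_lt h2 (lt_of_lt_of_le h (hf _ _ h1))

lemma bt_anti {S : Set Cell} (hS : IsYoung S) {i j : ℕ} (h : i < j) : bt S j < bt S i := by
  have := rl_anti hS h.le
  unfold bt; omega

lemma bt_anti_iff {S : Set Cell} (hS : IsYoung S) {i j : ℕ} : bt S j < bt S i ↔ i < j := by
  constructor
  · intro h
    by_contra hcon
    rcases Nat.eq_or_lt_of_le (not_lt.1 hcon) with h1 | h1
    · subst h1; exact lt_irrefl _ h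
    · have := bt_anti hS h1; omega
  · exact bt_anti hS

lemma bt_inj {S : Set Cell} (hS : IsYoung S) {i j : ℕ} (h : bt S i = bt S j) : i = j := by
  rcases lt_trichotomy i j with h1 | h1 | h1
  · have := bt_anti hS h1; omega
  · exact h1
  · have := bt_anti hS h1; omega

lemma young_tr {S : Set Cell} (hS : IsYoung S) : IsYoung (transposeSet S) := by
  refine ⟨?_, ?_⟩
  · apply (hS.1.image Prod.swap).subset
    rintro ⟨i, j⟩ h
    exact ⟨(j, i), h, rfl⟩
  · rintro p hp q h1 h2
    exact hS.2 _ hp (q.2, q.1) h2 h1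

lemma tr_tr (S : Set Cell) : transposeSet (transposeSet S) = S := rfl

def gm (S : Set Cell) (j : ℕ) : ℤ := (j : ℤ) + 1 - rl (transposeSet S) j

lemma rl_tr {S : Set Cell} (hS : IsYoung S) (i j : ℕ) :
    i < rl (transposeSet S) j ↔ j < rl S i := by
  rw [← mem_iff_rl hS, ← mem_iff_rl (young_tr hS)]; rfl

lemma gm_lt {S : Set Cell} (hS : IsYoung S) (i j : ℕ) : gm S j < bt S i ↔ j < rl S i := by
  have := rl_tr hS i j
  unfold gm bt
  omega

lemma gm_ne {S : Set Cell} (hS : IsYoung S) (i j : ℕ) : gm S j ≠ bt S i := by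
  have := rl_tr hS i j
  unfold gm bt
  omega

lemma bt_or_gm {S : Set Cell} (hS : IsYoung S) (x : ℤ) :
    (∃ i, bt S i = x) ∨ ∃ j, gm S j = x := by
  have hex : ∃ i, bt S i ≤ x := by
    obtain ⟨N, hN⟩ := rl_ev hS
    refine ⟨N + (-x).toNat, ?_⟩
    have := hN (N + (-x).toNat) (by omega)
    unfold bt
    rw [this]; omega
  have h1 := Nat.find_spec hex
  have h2 := fun m => Nat.find_min hex (m := m)
  set i := Nat.find hex with hi
  rcases eq_or_lt_of_le h1 with h3 | h3
  · exact Or.inl ⟨i, h3⟩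
  right
  have hr : (rl S i : ℤ) - i < x := h3
  refine ⟨(x + i - 1).toNat, ?_⟩
  have e : ((x + i - 1).toNat : ℤ) = x + i - 1 := by omega
  have a1 := rl_tr hS i (x + i - 1).toNat
  have a2 : i - 1 < rl (transposeSet S) (x + i - 1).toNat ∨ i = 0 := by
    rcases Nat.eq_zero_or_pos i with h0 | h0
    · exact Or.inr h0
    left
    rw [rl_tr hS]
    have := h2 (i - 1) (by omega)
    unfold bt at this
    omega
  unfold gm
  omega

lemma hookLen_eq {S : Set Cell} (hS : IsYoung S) {i j : ℕ} (h : (i, j) ∈ S) :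
    (hookLen S (i, j) : ℤ) = bt S i - gm S j := by
  have h1 : {j' | j < j' ∧ (i, j') ∈ S} = Set.Ioo j (rl S i) := by
    ext x; simp [mem_iff_rl hS]
  have h2 : {i' | i < i' ∧ (i', j) ∈ S} = Set.Ioo i (rl (transposeSet S) j) := by
    ext x; simp [mem_iff_rl hS, rl_tr hS]
  have a1 := (mem_iff_rl hS i j).1 h
  have a2 := (rl_tr hS i j).2 a1
  unfold hookLen
  simp only
  rw [h1, h2, ← Finset.coe_Ioo, ← Finset.coe_Ioo, Set.ncard_coe_finset, Set.ncard_coe_finset,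
    Nat.card_Ioo, Nat.card_Ioo]
  unfold bt gm
  omega

lemma core_iff {k : ℕ} {S : Set Cell} (hS : IsYoung S) :
    IsCore k S ↔ ∀ i, ∃ m, bt S m = bt S i - (k + 1) := by
  constructor
  · intro h i
    rcases bt_or_gm hS (bt S i - (k + 1)) with h1 | ⟨j, hj⟩
    · exact h1
    · exfalso
      have h2 : (i, j) ∈ S := by
        rw [mem_iff_rl hS, ← gm_lt hS]; omega
      have h3 := hookLen_eq hS h2
      have := h.2 _ h2
      omega
  · intro h
    refine ⟨hS, ?_⟩
    rintro ⟨i, j⟩ hc he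
    have h3 := hookLen_eq hS hc
    obtain ⟨m, hm⟩ := h i
    exact gm_ne hS m j (by omega)

def pr (k : ℕ) (S : Set Cell) (i : ℕ) : ℕ := {j | (i, j) ∈ S ∧ hookLen S (i, j) ≤ k}.ncard

lemma pMap_eq (k : ℕ) (S : Set Cell) : pMap k S = {c : Cell | c.2 < pr k S c.1} := rfl

lemma pr_eq {k : ℕ} {S : Set Cell} (hS : IsYoung S) {i m : ℕ}
    (hm : bt S m = bt S i - (k + 1)) : (pr k S i : ℤ) = k + 1 + i - m := by
  have him : i < m := (bt_anti_iff hS).1 (by omega)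
  have h1 : {j | (i, j) ∈ S ∧ hookLen S (i, j) ≤ k} = Set.Ico (rl S m) (rl S i) := by
    ext j
    rw [Set.mem_setOf_eq, Set.mem_Ico, mem_iff_rl hS, and_comm]
    apply and_congr_left
    intro hj
    have h3 := hookLen_eq hS ((mem_iff_rl hS i j).2 hj)
    have h4 := gm_lt hS m j
    have h5 := gm_ne hS m j
    omega
  unfold pr
  rw [h1, ← Finset.coe_Ico, Set.ncard_coe_finset, Nat.card_Ico]
  have := rl_anti hS him.le
  unfold bt at hm
  omega

lemma pr_le_rl {k : ℕ} {S : Set Cell} (hS : IsYoung S) (i : ℕ) : pr k S i ≤ rl S i :=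
  Set.ncard_le_ncard (fun _ hj => hj.1) (row_finite hS.1 i)

lemma pr_anti {k : ℕ} {S : Set Cell} (hS : IsCore k S) {i j : ℕ} (h : i ≤ j) :
    pr k S j ≤ pr k S i := by
  rcases Nat.eq_or_lt_of_le h with rfl | h
  · exact le_rfl
  induction j, h using Nat.le_induction with
  | base =>
    obtain ⟨m, hm⟩ := (core_iff hS.1).1 hS i
    obtain ⟨m', hm'⟩ := (core_iff hS.1).1 hS (i + 1)
    have h1 := pr_eq hS.1 hm
    have h2 := pr_eq hS.1 hm'
    have h3 : m < m' := (bt_anti_iff hS.1).1 (by have := bt_anti hS.1 (show i < i + 1 by omega); omega)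
    simp only [Nat.succ_eq_add_one] at *
    omega
  | succ j hj ih =>
    refine le_trans ?_ (ih (by omega))
    obtain ⟨m, hm⟩ := (core_iff hS.1).1 hS j
    obtain ⟨m', hm'⟩ := (core_iff hS.1).1 hS (j + 1)
    have h1 := pr_eq hS.1 hm
    have h2 := pr_eq hS.1 hm'
    have h3 : m < m' := (bt_anti_iff hS.1).1 (by have := bt_anti hS.1 (show j < j + 1 by omega); omega)
    omega

lemma pr_le {k : ℕ} {S : Set Cell} (hS : IsCore k S) (i : ℕ) : pr k S i ≤ k := by
  obtain ⟨m, hm⟩ := (core_iff hS.1).1 hS i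
  have h1 := pr_eq hS.1 hm
  have him : i < m := (bt_anti_iff hS.1).1 (by omega)
  omega

lemma pMap_young {k : ℕ} {S : Set Cell} (hS : IsCore k S) : IsYoung (pMap k S) := by
  obtain ⟨N, hN⟩ := rl_ev hS.1
  rw [pMap_eq]
  apply young_fun (N := N) (fun i j h => pr_anti hS h)
  intro i hi
  have := pr_le_rl (k := k) hS.1 i
  rw [hN i hi] at this
  omega

lemma pMap_bounded {k : ℕ} {S : Set Cell} (hS : IsCore k S) : IsBounded k (pMap k S) :=
  ⟨pMap_young hS, fun c hc => lt_of_lt_of_le hc (pr_le hS c.1)⟩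

lemma rl_pMap (k : ℕ) (S : Set Cell) (i : ℕ) : rl (pMap k S) i = pr k S i := by
  rw [pMap_eq, rl_fun]

lemma pMap_inj {k : ℕ} {S T : Set Cell} (hS : IsCore k S) (hT : IsCore k T)
    (h : pMap k S = pMap k T) : S = T := by
  obtain ⟨N, hN⟩ := rl_ev hS.1
  obtain ⟨N', hN'⟩ := rl_ev hT.1
  apply young_ext hS.1 hT.1
  have key : ∀ d i, N + N' - i ≤ d → rl S i = rl T i := by
    intro d
    induction d with
    | zero =>
      intro i hi
      rw [hN i (by omega), hN' i (by omega)]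
    | succ d ih =>
      intro i hi
      by_cases hc : N + N' ≤ i
      · exact ih i (by omega)
      obtain ⟨m, hm⟩ := (core_iff hS.1).1 hS i
      obtain ⟨m', hm'⟩ := (core_iff hT.1).1 hT i
      have h1 := pr_eq hS.1 hm
      have h2 := pr_eq hT.1 hm'
      have h3 : pr k S i = pr k T i := by rw [← rl_pMap, h, rl_pMap]
      have him : i < m := (bt_anti_iff hS.1).1 (by omega)
      have h4 : m = m' := by omega
      subst h4
      have := ih m (by omega)
      unfold bt at hm hm'
      omega
  exact fun i => key _ i le_rfl

def fF (k : ℕ) (p : ℕ → ℕ) : ℕ → ℕ → ℕ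
  | 0, _ => 0
  | d + 1, i => fF k p d (k + 1 + i - p i) + p i

lemma fF_stable {k : ℕ} {p : ℕ → ℕ} {N : ℕ} (hp : ∀ i, p i ≤ k) (hN : ∀ i, N ≤ i → p i = 0)
    (d : ℕ) : ∀ i, N ≤ d + i → fF k p (d + 1) i = fF k p d i := by
  induction d with
  | zero => intro i hi; simp [fF, hN i (by omega)]
  | succ d ih =>
    intro i hi
    rw [fF, ih _ (by have := hp i; omega)]
    rw [fF]

lemma fF_anti {k : ℕ} {p : ℕ → ℕ} (hp : ∀ i, p i ≤ k) (ha : ∀ i j, i ≤ j → p j ≤ p i)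
    (d : ℕ) : ∀ i j, i ≤ j → fF k p d j ≤ fF k p d i := by
  induction d with
  | zero => intro i j _; simp [fF]
  | succ d ih =>
    intro i j h
    rw [fF, fF]
    have h1 := ha i j h
    have h2 := hp i
    have := ih (k + 1 + i - p i) (k + 1 + j - p j) (by omega)
    omega

lemma fF_zero {k : ℕ} {p : ℕ → ℕ} {N : ℕ} (hp : ∀ i, p i ≤ k) (hN : ∀ i, N ≤ i → p i = 0)
    (d : ℕ) : ∀ i, N ≤ i → fF k p d i = 0 := by
  induction d with
  | zero => intro i _; simp [fF]
  | succ d ih =>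
    intro i h
    rw [fF, hN i h, ih _ (by omega)]

lemma pMap_surj {k : ℕ} {lam : Set Cell} (hl : IsBounded k lam) :
    ∃ S, IsCore k S ∧ pMap k S = lam := by
  obtain ⟨N, hN⟩ := rl_ev hl.1
  have hp : ∀ i, rl lam i ≤ k := by
    intro i
    by_contra hcon
    have := hl.2 _ ((mem_iff_rl hl.1 i k).2 (by omega))
    simp at this
  have ha : ∀ i j, i ≤ j → rl lam j ≤ rl lam i := fun i j h => rl_anti hl.1 h
  set f := fF k (rl lam) N with hf
  have hY : IsYoung {c : Cell | c.2 < f c.1} :=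
    young_fun (fF_anti hp ha N) (fF_zero hp hN N)
  have hb : ∀ i, bt {c : Cell | c.2 < f c.1} i = (f i : ℤ) - i := by
    intro i; unfold bt; rw [rl_fun]
  have hm : ∀ i, bt {c : Cell | c.2 < f c.1} (k + 1 + i - rl lam i) =
      bt {c : Cell | c.2 < f c.1} i - (k + 1) := by
    intro i
    rw [hb, hb]
    have h1 := fF_stable hp hN N i (by omega)
    rw [fF] at h1
    have := hp i
    rw [hf]
    omega
  have hC : IsCore k {c : Cell | c.2 < f c.1} := (core_iff hY).2 (fun i => ⟨_, hm i⟩)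
  refine ⟨_, hC, ?_⟩
  apply young_ext (pMap_young hC) hl.1
  intro i
  rw [rl_pMap]
  have h1 := pr_eq hY (hm i)
  have := hp i
  omega

lemma pInv_core {k : ℕ} {lam : Set Cell} (hl : IsBounded k lam) : IsCore k (pInv k lam) :=
  Function.invFunOn_mem (s := {S | IsCore k S}) (pMap_surj hl)

lemma pMap_pInv {k : ℕ} {lam : Set Cell} (hl : IsBounded k lam) : pMap k (pInv k lam) = lam :=
  Function.invFunOn_eq (s := {S | IsCore k S}) (pMap_surj hl)

lemma pInv_pMap {k : ℕ} {S : Set Cell} (hS : IsCore k S) : pInv k (pMap k S) = S :=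
  pMap_inj (pInv_core (pMap_bounded hS)) hS (pMap_pInv (pMap_bounded hS))

lemma hookLen_tr (S : Set Cell) (c : Cell) :
    hookLen (transposeSet S) (c.2, c.1) = hookLen S c := by
  unfold hookLen transposeSet
  simp only [Set.mem_setOf_eq]
  omega

lemma core_tr {k : ℕ} {S : Set Cell} (hS : IsCore k S) : IsCore k (transposeSet S) := by
  refine ⟨young_tr hS.1, fun c hc => ?_⟩
  have := hS.2 _ hc
  rw [← hookLen_tr] at this
  exact this


/-! ### The star action on Young diagrams -/

lemma addable_iff {S : Set Cell} (hS : IsYoung S) (c : Cell) :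
    Addable S c ↔ c ∉ S ∧ (∀ i, c.1 = i + 1 → (i, c.2) ∈ S) ∧ (∀ j, c.2 = j + 1 → (c.1, j) ∈ S) := by
  obtain ⟨a, b⟩ := c
  unfold Addable
  apply and_congr_right
  intro hc
  constructor
  · intro h
    refine ⟨?_, ?_⟩
    · intro i hi
      have := h.2 (a, b) (Or.inr rfl) (i, b) (by simp at hi ⊢; omega) le_rfl
      rcases this with h1 | h1
      · exact h1
      · simp at h1 hi; omega
    · intro j hj
      have := h.2 (a, b) (Or.inr rfl) (a, j) le_rfl (by simp at hj ⊢; omega)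
      rcases this with h1 | h1
      · exact h1
      · simp at h1 hj; omega
  · rintro ⟨h1, h2⟩
    refine ⟨hS.1.union (Set.finite_singleton _), ?_⟩
    rintro p (hp | hp) ⟨q1, q2⟩ hq1 hq2
    · exact Or.inl (hS.2 p hp _ hq1 hq2)
    · rw [Set.mem_singleton_iff] at hp
      subst hp
      simp only at hq1 hq2 h1 h2
      by_cases e1 : q1 = a
      · by_cases e2 : q2 = b
        · right; rw [e1, e2]; rfl
        · left
          exact hS.2 _ (h2 (b - 1) (by omega)) _ hq1 (by simp only; omega)
      · left
        exact hS.2 _ (h1 (a - 1) (by omega)) _ (by simp only; omega) hq2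

def addS (k : ℕ) (v : Idx k) (S : Set Cell) : Set Cell := S ∪ {c | Addable S c ∧ res k c = v}

lemma addS_young {k : ℕ} {v : Idx k} {S : Set Cell} (hS : IsYoung S) : IsYoung (addS k v S) := by
  refine ⟨?_, ?_⟩
  · apply hS.1.union
    apply ((hS.1.image (fun c : Cell => (c.1 + 1, c.2))).union
      ((hS.1.image (fun c : Cell => (c.1, c.2 + 1))).union (Set.finite_singleton (0, 0)))).subset
    rintro ⟨a, b⟩ ⟨h, -⟩
    rw [addable_iff hS] at h
    rcases a with _ | a
    · rcases b with _ | b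
      · right; right; rfl
      · right; left; exact ⟨(0, b), h.2.2 b rfl, rfl⟩
    · left; exact ⟨(a, b), h.2.1 a rfl, rfl⟩
  · rintro p (hp | hp) q h1 h2
    · exact Or.inl (hS.2 p hp q h1 h2)
    · rcases hp.1.2.2 p (Or.inr rfl) q h1 h2 with h | h
      · exact Or.inl h
      · rw [Set.mem_singleton_iff] at h; subst h; exact Or.inr hp

lemma starC_some {k : ℕ} {v : Idx k} {S S' : Set Cell} (h : starC k v (some S) = some S') :
    S' = addS k v S := by
  unfold starC at h
  simp only at h
  split_ifs at h with h1 h2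
  · exact (Option.some.inj h).symm
  · rw [← Option.some.inj h]
    ext c
    constructor
    · exact Or.inl
    · rintro (hc | hc)
      · exact hc
      · exact absurd ⟨c, hc⟩ h1

lemma starC_young {k : ℕ} {v : Idx k} {S S' : Set Cell} (hS : IsYoung S)
    (h : starC k v (some S) = some S') : IsYoung S' := by
  rw [starC_some h]; exact addS_young hS

lemma res_up (k a b : ℕ) : res k (a, b) = res k (a + 1, b) + 1 := by
  unfold res; push_cast; ring

lemma res_left (k a b : ℕ) : res k (a, b + 1) = res k (a, b) + 1 := by
  unfold res; push_cast; ring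

lemma ne_succ {k : ℕ} (hk : 1 ≤ k) (v : Idx k) : v ≠ v + 1 := by
  intro h
  have h1 : (1 : Idx k) = 0 := by
    have : v + 0 = v + 1 := by rw [add_zero]; exact h
    exact (add_left_cancel this).symm
  have : Fact (1 < k + 1) := ⟨by omega⟩
  exact one_ne_zero h1

/-- Adding cells of residue `v` does not change addable cells of a far residue. -/
lemma addable_far {k : ℕ} {v w : Idx k} {S : Set Cell} (hS : IsYoung S) (hvw : v ≠ w)
    (hn : NonAdj v w) {c : Cell} (hc : res k c = w) :
    Addable (addS k v S) c ↔ Addable S c := by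
  have key : ∀ d : Cell, res k d ≠ v → (d ∈ addS k v S ↔ d ∈ S) := by
    intro d hd
    constructor
    · rintro (h | h)
      · exact h
      · exact absurd h.2 hd
    · exact Or.inl
  obtain ⟨a, b⟩ := c
  rw [addable_iff hS, addable_iff (addS_young hS)]
  rw [key _ (by rw [hc]; exact hvw.symm)]
  apply and_congr_right
  intro _
  apply and_congr
  · apply forall_congr'; intro i
    apply imp_congr_right
    intro hi
    simp only at hi
    subst hi
    apply key
    have := res_up k i b
    rw [hc] at this
    simp only [this]
    exact fun h => hn.1 h.symm
  · apply forall_congr'; intro j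
    apply imp_congr_right
    intro hj
    simp only at hj
    subst hj
    apply key
    have := res_left k a j
    rw [hc] at this
    intro h
    simp only at h
    rw [h] at this
    exact hn.2 this

lemma removable_far {k : ℕ} {v w : Idx k} {S : Set Cell} (hvw : v ≠ w)
    (hn : NonAdj v w) {c : Cell} (hc : res k c = w) :
    Removable (addS k v S) c ↔ Removable S c := by
  have key : ∀ d : Cell, res k d ≠ v → (d ∈ addS k v S ↔ d ∈ S) := by
    intro d hd
    constructor
    · rintro (h | h)
      · exact h
      · exact absurd h.2 hd
    · exact Or.inl
  obtain ⟨a, b⟩ := c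
  unfold Removable
  rw [key _ (by rw [hc]; exact hvw.symm), key (a + 1, b), key (a, b + 1)]
  · rw [res_left, hc]; exact fun h => hn.1 h.symm
  · have := res_up k a b
    rw [hc] at this
    intro h
    rw [h] at this
    exact hn.2 this

lemma addS_comm {k : ℕ} {v w : Idx k} {S : Set Cell} (hS : IsYoung S) (hvw : v ≠ w)
    (hn : NonAdj v w) : addS k v (addS k w S) = addS k w (addS k v S) := by
  have h1 : {c | Addable (addS k w S) c ∧ res k c = v} = {c | Addable S c ∧ res k c = v} := by
    ext c
    exact and_congr_left (fun hc => addable_far hS hvw.symm ⟨hn.2, hn.1⟩ hc)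
  have h2 : {c | Addable (addS k v S) c ∧ res k c = w} = {c | Addable S c ∧ res k c = w} := by
    ext c
    exact and_congr_left (fun hc => addable_far hS hvw hn hc)
  rw [addS, h1, addS.eq_1 k w (addS k v S), h2, addS, addS, Set.union_right_comm]

/-- normal form of the action -/
lemma starC_eq (k : ℕ) (v : Idx k) (S : Set Cell) : starC k v (some S) =
    if ∃ c, (Addable S c ∨ Removable S c) ∧ res k c = v then some (addS k v S) else none := by
  have e : (¬ ∃ c, Addable S c ∧ res k c = v) → addS k v S = S := by
    intro h
    ext c
    constructor
    · rintro (hc | hc)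
      · exact hc
      · exact absurd ⟨c, hc⟩ h
    · exact Or.inl
  unfold starC
  simp only
  by_cases h1 : ∃ c, Addable S c ∧ res k c = v
  · rw [if_pos h1, if_pos (h1.imp fun c hc => ⟨Or.inl hc.1, hc.2⟩)]; rfl
  rw [if_neg h1]
  by_cases h2 : ∃ c, Removable S c ∧ res k c = v
  · rw [if_pos h2, if_pos (h2.imp fun c hc => ⟨Or.inr hc.1, hc.2⟩), e h1]
  rw [if_neg h2, if_neg]
  rintro ⟨c, hc | hc, hr⟩
  · exact h1 ⟨c, hc, hr⟩
  · exact h2 ⟨c, hc, hr⟩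

lemma starC_comm {k : ℕ} {v w : Idx k} {S : Set Cell} (hS : IsYoung S)
    (hn : NonAdj v w) : starC k v (starC k w (some S)) = starC k w (starC k v (some S)) := by
  by_cases hvw : v = w
  · rw [hvw]
  have h1 : (∃ c, (Addable (addS k w S) c ∨ Removable (addS k w S) c) ∧ res k c = v) ↔
      ∃ c, (Addable S c ∨ Removable S c) ∧ res k c = v := by
    apply exists_congr; intro c
    apply and_congr_left; intro hc
    rw [addable_far hS (Ne.symm hvw) ⟨hn.2, hn.1⟩ hc,
      removable_far (Ne.symm hvw) ⟨hn.2, hn.1⟩ hc]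
  have h2 : (∃ c, (Addable (addS k v S) c ∨ Removable (addS k v S) c) ∧ res k c = w) ↔
      ∃ c, (Addable S c ∨ Removable S c) ∧ res k c = w := by
    apply exists_congr; intro c
    apply and_congr_left; intro hc
    rw [addable_far hS hvw hn hc, removable_far hvw hn hc]
  rw [starC_eq k w S, starC_eq k v S]
  split_ifs with a1 a2 a2
  · rw [starC_eq, starC_eq, if_pos (h1.2 a2), if_pos (h2.2 a1), addS_comm hS hvw hn]
  · rw [starC_eq, if_neg (fun h => a2 (h1.1 h))]; rfl
  · rw [starC_eq, if_neg (fun h => a1 (h2.1 h))]; rfl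
  · rfl

lemma starC_idem {k : ℕ} (hk : 1 ≤ k) {v : Idx k} {S : Set Cell} (hS : IsYoung S) :
    starC k v (starC k v (some S)) = starC k v (some S) := by
  by_cases h1 : ∃ c, Addable S c ∧ res k c = v
  · have e : starC k v (some S) = some (addS k v S) := by
      unfold starC; simp only; rw [if_pos h1]; rfl
    rw [e]
    have key : ∀ d : Cell, res k d ≠ v → (d ∈ addS k v S ↔ d ∈ S) := by
      intro d hd
      constructor
      · rintro (h | h)
        · exact h
        · exact absurd h.2 hd
      · exact Or.inl
    have h2 : ¬ ∃ c, Addable (addS k v S) c ∧ res k c = v := by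
      rintro ⟨⟨a, b⟩, hc, hr⟩
      apply hc.1
      right
      refine ⟨?_, hr⟩
      rw [addable_iff (addS_young hS)] at hc
      rw [addable_iff hS]
      refine ⟨fun h => hc.1 (Or.inl h), ?_, ?_⟩
      · intro i hi
        refine (key _ ?_).1 (hc.2.1 i hi)
        simp only at hi ⊢
        subst hi
        rw [res_up, hr]
        exact (ne_succ hk v).symm
      · intro j hj
        refine (key _ ?_).1 (hc.2.2 j hj)
        simp only at hj ⊢
        subst hj
        rw [res_left] at hr
        rw [← hr]
        exact ne_succ hk _
    have h3 : ∃ c, Removable (addS k v S) c ∧ res k c = v := by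
      obtain ⟨⟨a, b⟩, hc, hr⟩ := h1
      refine ⟨(a, b), ⟨Or.inr ⟨hc, hr⟩, ?_, ?_⟩, hr⟩
      · intro h
        rw [key] at h
        · exact hc.1 (hS.2 _ h _ (by simp) (by simp))
        · simp only
          rw [res_up] at hr
          rw [← hr]
          exact ne_succ hk _
      · intro h
        rw [key] at h
        · exact hc.1 (hS.2 _ h _ (by simp) (by simp))
        · simp only
          rw [res_left, hr]
          exact (ne_succ hk _).symm
    unfold starC
    simp only
    rw [if_neg h2, if_pos h3]
  · have : starC k v (some S) = some S ∨ starC k v (some S) = none := by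
      unfold starC; simp only; rw [if_neg h1]
      split_ifs
      · exact Or.inl rfl
      · exact Or.inr rfl
    rcases this with h | h
    · rw [h, h]
    · rw [h]; rfl

lemma starCW_nil (k : ℕ) (o : Option (Set Cell)) : starCW k [] o = o := rfl
lemma starCW_cons (k : ℕ) (v : Idx k) (u : Word k) (o : Option (Set Cell)) :
    starCW k (v :: u) o = starC k v (starCW k u o) := rfl
lemma starCW_append (k : ℕ) (u w : Word k) (o : Option (Set Cell)) :
    starCW k (u ++ w) o = starCW k u (starCW k w o) := by
  unfold starCW; rw [List.foldr_append]
lemma starCW_none (k : ℕ) (u : Word k) : starCW k u none = none := by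
  induction u with
  | nil => rfl
  | cons v u ih => rw [starCW_cons, ih]; rfl

lemma starCW_cons_some {k : ℕ} {v : Idx k} {u : Word k} {S S' : Set Cell}
    (h : starCW k (v :: u) (some S) = some S') :
    ∃ T, starCW k u (some S) = some T ∧ starC k v (some T) = some S' := by
  rw [starCW_cons] at h
  cases hT : starCW k u (some S) with
  | none => rw [hT] at h; simp [starC] at h
  | some T => rw [hT] at h; exact ⟨T, rfl, h⟩

lemma starCW_append_some {k : ℕ} {w u : Word k} {S S' : Set Cell}
    (h : starCW k (w ++ u) (some S) = some S') :
    ∃ T, starCW k u (some S) = some T ∧ starCW k w (some T) = some S' := by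
  rw [starCW_append] at h
  cases hT : starCW k u (some S) with
  | none => rw [hT, starCW_none] at h; simp at h
  | some T => rw [hT] at h; exact ⟨T, rfl, h⟩

lemma starCW_young {k : ℕ} {u : Word k} {S : Set Cell} (hS : IsYoung S) :
    ∀ {S' : Set Cell}, starCW k u (some S) = some S' → IsYoung S' := by
  induction u with
  | nil => intro S' h; rw [starCW_nil] at h; rw [← Option.some.inj h]; exact hS
  | cons v u ih =>
    intro S' h
    obtain ⟨T, h1, h2⟩ := starCW_cons_some h
    exact starC_young (ih h1) h2

/-- The monoid acting. -/
abbrev YO := {o : Option (Set Cell) // ∀ S, o = some S → IsYoung S}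

def aY (k : ℕ) (v : Idx k) : Function.End YO := fun o =>
  ⟨starC k v o.1, fun S hS => by
    obtain ⟨o, ho⟩ := o
    cases o with
    | none => simp [starC] at hS
    | some T => exact starC_young (ho T rfl) hS⟩

lemma aY_comm {k : ℕ} {v w : Idx k} (hn : NonAdj v w) : Commute (aY k v) (aY k w) := by
  funext o
  apply Subtype.ext
  obtain ⟨o, ho⟩ := o
  cases o with
  | none => rfl
  | some T => exact starC_comm (ho T rfl) hn

lemma aY_prod (k : ℕ) (u : Word k) (o : YO) :
    ((u.map (aY k)).prod o).1 = starCW k u o.1 := by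
  induction u with
  | nil => rfl
  | cons v u ih =>
    rw [List.map_cons, List.prod_cons, starCW_cons, ← ih]
    rfl


/-! ### One step of the star action on cores -/

def Mv (k : ℕ) (v : Idx k) (S : Set Cell) (i : ℕ) : Prop :=
  ((bt S i : ℤ) : Idx k) = v ∧ ∀ l, bt S l ≠ bt S i + 1

lemma addable_bt {S : Set Cell} (hS : IsYoung S) (i j : ℕ) :
    Addable S (i, j) ↔ j = rl S i ∧ ∀ l, bt S l ≠ bt S i + 1 := by
  rw [addable_iff hS]
  simp only [mem_iff_rl hS]
  constructor
  · rintro ⟨h1, h2, h3⟩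
    have hj : j = rl S i := by
      rcases j with _ | j
      · omega
      · have := h3 j rfl; omega
    refine ⟨hj, ?_⟩
    intro l hl
    have hli : l < i := (bt_anti_iff hS).1 (by omega)
    have h4 := h2 (i - 1) (by omega)
    have h5 := rl_anti hS (show l ≤ i - 1 by omega)
    unfold bt at hl
    omega
  · rintro ⟨h1, h2⟩
    refine ⟨by omega, ?_, by intro j' hj'; omega⟩
    intro l hl
    have h3 := h2 l
    have h4 := rl_anti hS (show l ≤ i by omega)
    unfold bt at h3
    omega

lemma res_bt (k : ℕ) (S : Set Cell) (i : ℕ) : res k (i, rl S i) = ((bt S i : ℤ) : Idx k) := by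
  unfold res bt; push_cast; rfl

lemma bt_addS {k : ℕ} {v : Idx k} {S : Set Cell} (hS : IsYoung S) (i : ℕ) :
    bt (addS k v S) i = bt S i + if Mv k v S i then 1 else 0 := by
  have key : ∀ j, j < rl (addS k v S) i ↔ (j < rl S i ∨ (j = rl S i ∧ Mv k v S i)) := by
    intro j
    rw [← mem_iff_rl (addS_young hS), ← mem_iff_rl hS]
    apply or_congr Iff.rfl
    change Addable S (i, j) ∧ res k (i, j) = v ↔ _
    rw [addable_bt hS]
    unfold Mv
    constructor
    · rintro ⟨⟨h1, h2⟩, h3⟩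
      subst h1
      rw [res_bt] at h3
      exact ⟨rfl, h3, h2⟩
    · rintro ⟨h1, h3, h2⟩
      subst h1
      rw [res_bt]
      exact ⟨⟨rfl, h2⟩, h3⟩
  unfold bt
  by_cases hm : Mv k v S i
  · simp only [hm, and_true, if_true] at *
    have h1 := key (rl S i)
    have h2 := key (rl S i + 1)
    omega
  · simp only [hm, and_false, or_false, if_false] at *
    have h1 := key (rl S i)
    have h2 := key (rl (addS k v S) i)
    omega

lemma cast_shift (k : ℕ) (x : ℤ) : ((x - (k + 1) : ℤ) : Idx k) = ((x : ℤ) : Idx k) := by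
  have : ((k + 1 : ℕ) : Idx k) = 0 := ZMod.natCast_self (k + 1)
  push_cast at *
  rw [this, sub_zero]

/-- The one-step comparison of the `m`-functions. -/
lemma step_m {k : ℕ} (hk : 1 ≤ k) {v : Idx k} {S : Set Cell} (hS : IsCore k S) {i m : ℕ}
    (hm : bt S m = bt S i - (k + 1)) :
    (bt (addS k v S) m = bt (addS k v S) i - (k + 1)) ∨
    (Mv k v S i ∧ ¬ Mv k v S m ∧ 1 ≤ m ∧ bt S (m - 1) = bt S m + 1 ∧
      bt (addS k v S) (m - 1) = bt (addS k v S) i - (k + 1)) := by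
  have hc : ((bt S m : ℤ) : Idx k) = ((bt S i : ℤ) : Idx k) := by rw [hm, cast_shift]
  rw [bt_addS hS.1, bt_addS hS.1]
  by_cases h1 : Mv k v S i
  · by_cases h2 : Mv k v S m
    · left; simp [h1, h2]; omega
    · right
      refine ⟨h1, h2, ?_⟩
      have h3 : ∃ l, bt S l = bt S m + 1 := by
        by_contra hcon
        push Not at hcon
        exact h2 ⟨hc.trans h1.1, hcon⟩
      obtain ⟨l, hl⟩ := h3
      have h4 : l < m := (bt_anti_iff hS.1).1 (by omega)
      have h5 : l = m - 1 := by
        by_contra hcon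
        have a1 := bt_anti hS.1 (show l < m - 1 by omega)
        have a2 := bt_anti hS.1 (show m - 1 < m by omega)
        omega
      subst h5
      have h6 : ¬ Mv k v S (m - 1) := by
        intro h
        have h7 := h.1
        rw [hl] at h7
        push_cast at h7
        rw [hc, h1.1] at h7
        exact ne_succ hk v h7.symm
      refine ⟨by omega, hl, ?_⟩
      rw [bt_addS hS.1]
      simp [h1, h6]; omega
  · left
    have h2 : ¬ Mv k v S m := by
      intro h2
      apply h1
      refine ⟨hc.symm.trans h2.1, ?_⟩
      intro l hl
      obtain ⟨l', hl'⟩ := (core_iff hS.1).1 hS l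
      exact h2.2 l' (by omega)
    simp [h1, h2]; omega

lemma addS_core {k : ℕ} (hk : 1 ≤ k) {v : Idx k} {S : Set Cell} (hS : IsCore k S) :
    IsCore k (addS k v S) := by
  rw [core_iff (addS_young hS.1)]
  intro i
  obtain ⟨m, hm⟩ := (core_iff hS.1).1 hS i
  rcases step_m hk (v := v) hS hm with h | ⟨-, -, -, -, h⟩
  · exact ⟨_, h⟩
  · exact ⟨_, h⟩

lemma core_down {k : ℕ} {S : Set Cell} (hS : IsCore k S) (i t : ℕ) :
    ∃ m, bt S m = bt S i - (k + 1) * t := by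
  induction t with
  | zero => exact ⟨i, by simp⟩
  | succ t ih =>
    obtain ⟨m, hm⟩ := ih
    obtain ⟨m', hm'⟩ := (core_iff hS.1).1 hS m
    refine ⟨m', ?_⟩
    rw [hm', hm]; push_cast; ring

lemma step_pr {k : ℕ} (hk : 1 ≤ k) {v : Idx k} {S : Set Cell} (hS : IsCore k S) (i : ℕ) :
    pr k (addS k v S) i = pr k S i ∨ (pr k (addS k v S) i = pr k S i + 1 ∧ Mv k v S i ∧
      ∃ l, bt S l = bt S i - (k + 1) + 1) := by
  obtain ⟨m, hm⟩ := (core_iff hS.1).1 hS i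
  have h1 := pr_eq hS.1 hm
  rcases step_m hk (v := v) hS hm with h | ⟨a1, -, a2, a3, h⟩
  · left
    have := pr_eq (addS_young hS.1) h
    omega
  · right
    have := pr_eq (addS_young hS.1) h
    exact ⟨by omega, a1, m - 1, by omega⟩

lemma step_unique {k : ℕ} {v : Idx k} {S : Set Cell} (hS : IsCore k S) {i j l : ℕ}
    (hi : Mv k v S i) (hj : Mv k v S j) (hl : bt S l = bt S i - (k + 1) + 1) : j ≤ i := by
  by_contra hcon
  have h1 := bt_anti hS.1 (not_le.1 hcon)
  have h2 : ((bt S j : ℤ) : Idx k) = ((bt S i : ℤ) : Idx k) := hj.1.trans hi.1.symm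
  rw [ZMod.intCast_eq_intCast_iff_dvd_sub] at h2
  obtain ⟨c, hc⟩ := h2
  push_cast at hc
  have hc0 : 0 < c := by
    by_contra hneg
    have : ((k : ℤ) + 1) * c ≤ 0 := mul_nonpos_of_nonneg_of_nonpos (by omega) (by omega)
    omega
  obtain ⟨t, rfl⟩ : ∃ t : ℕ, c = t + 1 := ⟨(c - 1).toNat, by omega⟩
  obtain ⟨m, hm⟩ := core_down hS l t
  apply hj.2 m
  rw [hm, hl]
  linarith

lemma step_pMap {k : ℕ} (hk : 1 ≤ k) {v : Idx k} {S : Set Cell} (hS : IsCore k S) :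
    pMap k S ⊆ pMap k (addS k v S) ∧ (pMap k (addS k v S) \ pMap k S).ncard ≤ 1 := by
  refine ⟨?_, ?_⟩
  · rintro ⟨i, j⟩ h
    rw [pMap_eq] at *
    simp only [Set.mem_ofPred_eq] at *
    rcases step_pr hk (v := v) hS i with h1 | h1 <;> omega
  · rw [Set.ncard_le_one (Set.Finite.subset (pMap_young (addS_core hk hS)).1 Set.diff_subset)]
    rintro ⟨i, j⟩ ⟨h1, h2⟩ ⟨i', j'⟩ ⟨h1', h2'⟩
    rw [pMap_eq] at *
    simp only [Set.mem_ofPred_eq] at *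
    rcases step_pr hk (v := v) hS i with h3 | ⟨h3, h4, l, hl⟩
    · omega
    rcases step_pr hk (v := v) hS i' with h3' | ⟨h3', h4', l', hl'⟩
    · omega
    have e1 := step_unique hS h4 h4' hl
    have e2 := step_unique hS h4' h4 hl'
    have e : i = i' := by omega
    subst e
    simp only [Prod.mk.injEq, true_and]
    omega

lemma starCW_core {k : ℕ} (hk : 1 ≤ k) {u : Word k} {S : Set Cell} (hS : IsCore k S) :
    ∀ {S' : Set Cell}, starCW k u (some S) = some S' →
      IsCore k S' ∧ S ⊆ S' ∧ pMap k S ⊆ pMap k S' ∧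
        (pMap k S' \ pMap k S).ncard ≤ u.length := by
  induction u with
  | nil =>
    intro S' h; rw [starCW_nil] at h; rw [← Option.some.inj h]
    refine ⟨hS, subset_rfl, subset_rfl, ?_⟩
    simp
  | cons v u ih =>
    intro S' h
    obtain ⟨T, h1, h2⟩ := starCW_cons_some h
    obtain ⟨a1, a2, a3, a4⟩ := ih h1
    rw [starC_some h2]
    have b := step_pMap hk (v := v) a1
    have c := addS_core hk (v := v) a1
    refine ⟨c, a2.trans (fun _ => Or.inl), a3.trans b.1, ?_⟩
    have hsub : pMap k (addS k v T) \ pMap k S ⊆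
        (pMap k (addS k v T) \ pMap k T) ∪ (pMap k T \ pMap k S) := by
      intro x hx
      by_cases hT : x ∈ pMap k T
      · exact Or.inr ⟨hT, hx.2⟩
      · exact Or.inl ⟨hx.1, hT⟩
    have f1 := (pMap_young c).1.subset (Set.diff_subset (t := pMap k T))
    have f2 := (pMap_young a1).1.subset (Set.diff_subset (t := pMap k S))
    have := (Set.ncard_le_ncard hsub (f1.union f2)).trans (Set.ncard_union_le _ _)
    rw [List.length_cons]
    omega

/-! ### Strips -/

lemma starCW_res {k : ℕ} {u : Word k} {S : Set Cell} :
    ∀ {S' : Set Cell}, starCW k u (some S) = some S' → ∀ c ∈ S', c ∉ S → res k c ∈ u := by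
  induction u with
  | nil =>
    intro S' h c h1 h2; rw [starCW_nil] at h; rw [← Option.some.inj h] at h1
    exact absurd h1 h2
  | cons v u ih =>
    intro S' h c h1 h2
    obtain ⟨T, h3, h4⟩ := starCW_cons_some h
    rw [starC_some h4] at h1
    rcases h1 with h1 | h1
    · exact List.mem_cons_of_mem _ (ih h3 c h1 h2)
    · rw [h1.2]; exact List.mem_cons_self

lemma starCW_hstrip {k : ℕ} {u : Word k} (hu : u.Pairwise (fun x y => y ≠ x + 1))
    {S : Set Cell} (hS : IsYoung S) :
    ∀ {S' : Set Cell}, starCW k u (some S) = some S' →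
      ∀ a b, (a + 1, b) ∈ S' → (a + 1, b) ∉ S → (a, b) ∈ S := by
  induction u with
  | nil =>
    intro S' h a b h1 h2; rw [starCW_nil] at h; rw [← Option.some.inj h] at h1
    exact absurd h1 h2
  | cons v u ih =>
    intro S' h a b h1 h2
    obtain ⟨T, h3, h4⟩ := starCW_cons_some h
    rw [List.pairwise_cons] at hu
    rw [starC_some h4] at h1
    rcases h1 with h1 | ⟨h1, hr⟩
    · exact ih hu.2 h3 a b h1 h2
    · by_contra hcon
      rw [addable_iff (starCW_young hS h3)] at h1
      have h5 := h1.2.1 a rfl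
      have h6 := starCW_res h3 _ h5 hcon
      apply hu.1 _ h6
      simp only
      rw [res_up, hr]

lemma strip_pr {k : ℕ} {S S' : Set Cell} (hS : IsCore k S) (hS' : IsCore k S') (hsub : S ⊆ S')
    (h : ∀ a b, (a + 1, b) ∈ S' → (a + 1, b) ∉ S → (a, b) ∈ S) (i : ℕ) :
    pr k S' (i + 1) ≤ pr k S i := by
  have h1 : rl S' (i + 1) ≤ rl S i := by
    by_contra hcon
    have h2 : (i + 1, rl S i) ∈ S' := (mem_iff_rl hS'.1 _ _).2 (by omega)
    have h3 : (i, rl S i) ∈ S := by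
      by_cases hc : (i + 1, rl S i) ∈ S
      · exact hS.1.2 _ hc _ (by simp) le_rfl
      · exact h _ _ h2 hc
    rw [mem_iff_rl hS.1] at h3
    omega
  obtain ⟨m, hm⟩ := (core_iff hS.1).1 hS i
  obtain ⟨m', hm'⟩ := (core_iff hS'.1).1 hS' (i + 1)
  have a1 := pr_eq hS.1 hm
  have a2 := pr_eq hS'.1 hm'
  have h2 : bt S' (i + 1) < bt S i := by unfold bt; push_cast; omega
  have h3 : bt S m ≤ bt S' m := by
    have : rl S m ≤ rl S' m := Set.ncard_le_ncard (fun _ hj => hsub hj) (row_finite hS'.1.1 m)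
    unfold bt; omega
  have h4 : m < m' := (bt_anti_iff hS'.1).1 (by omega)
  omega

/-! ### Transposition -/

lemma addable_tr {S : Set Cell} (hS : IsYoung S) (c : Cell) :
    Addable (transposeSet S) (c.2, c.1) ↔ Addable S c := by
  rw [addable_iff (young_tr hS), addable_iff hS]
  apply and_congr Iff.rfl
  exact and_comm

lemma removable_tr (S : Set Cell) (c : Cell) :
    Removable (transposeSet S) (c.2, c.1) ↔ Removable S c := by
  unfold Removable
  apply and_congr Iff.rfl
  exact and_comm

lemma res_tr (k : ℕ) (c : Cell) : res k (c.2, c.1) = - res k c := by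
  unfold res; simp

lemma starC_tr {k : ℕ} (v : Idx k) {S : Set Cell} (hS : IsYoung S) :
    starC k (-v) (some (transposeSet S)) = (starC k v (some S)).map transposeSet := by
  rw [starC_eq, starC_eq]
  have e : (∃ c, (Addable (transposeSet S) c ∨ Removable (transposeSet S) c) ∧ res k c = -v) ↔
      ∃ c, (Addable S c ∨ Removable S c) ∧ res k c = v := by
    constructor
    · rintro ⟨c, h1, h2⟩
      refine ⟨(c.2, c.1), ?_, ?_⟩
      · rw [← addable_tr hS, ← removable_tr]; exact h1
      · rw [res_tr, h2, neg_neg]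
    · rintro ⟨c, h1, h2⟩
      refine ⟨(c.2, c.1), ?_, ?_⟩
      · rw [addable_tr hS, removable_tr]; exact h1
      · rw [res_tr, h2]
  by_cases h : ∃ c, (Addable S c ∨ Removable S c) ∧ res k c = v
  · rw [if_pos h, if_pos (e.2 h), Option.map_some]
    congr 1
    ext c
    apply or_congr Iff.rfl
    change (Addable (transposeSet S) c ∧ res k c = -v) ↔
      (Addable S (c.2, c.1) ∧ res k (c.2, c.1) = v)
    rw [← addable_tr hS, res_tr, neg_eq_iff_eq_neg]
  · rw [if_neg h, if_neg (fun h' => h (e.1 h'))]; rfl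

lemma starCW_tr {k : ℕ} {u : Word k} {S : Set Cell} (hS : IsYoung S) :
    ∀ {S' : Set Cell}, starCW k u (some S) = some S' →
      starCW k (u.map (fun x => -x)) (some (transposeSet S)) = some (transposeSet S') := by
  induction u with
  | nil => intro S' h; rw [starCW_nil] at h; rw [← Option.some.inj h]; rfl
  | cons v u ih =>
    intro S' h
    obtain ⟨T, h1, h2⟩ := starCW_cons_some h
    rw [List.map_cons, starCW_cons, ih h1, starC_tr _ (starCW_young hS h1), h2]; rfl

lemma neg_dtype {k : ℕ} {u : Word k} (hu : u.Pairwise (fun x y => x ≠ y + 1)) :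
    (u.map (fun x => -x)).Pairwise (fun x y => y ≠ x + 1) := by
  rw [List.pairwise_map]
  refine hu.imp ?_
  intro a b h h'
  apply h
  linear_combination h'

/-! ### Heights -/

lemma htSkew_le {D : Set Cell} (hD : D.Finite) :
    htSkew D ≤ {i : ℕ | ∃ j, (i, j) ∈ D ∧ (i + 1, j) ∈ D}.ncard := by
  have hf : {i : ℕ | ∃ j, (i, j) ∈ D}.Finite := by
    apply (hD.image Prod.fst).subset
    rintro i ⟨j, h⟩
    exact ⟨(i, j), h, rfl⟩
  have hsub : {i : ℕ | ∃ j, (i, j) ∈ D} ⊆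
      {i : ℕ | ∃ j, (i, j) ∈ D ∧ (i + 1, j) ∈ D} ∪
      {i : ℕ | (∃ j, (i, j) ∈ D) ∧ ¬∃ j, (i, j) ∈ D ∧ (i + 1, j) ∈ D} := by
    intro i hi
    by_cases h : ∃ j, (i, j) ∈ D ∧ (i + 1, j) ∈ D
    · exact Or.inl h
    · exact Or.inr ⟨hi, h⟩
  have h2 := Set.ncard_le_ncard hsub ((hf.subset (fun i hi => by
    obtain ⟨j, h, -⟩ := hi; exact ⟨j, h⟩)).union (hf.subset (fun i hi => hi.1)))
  have h3 := h2.trans (Set.ncard_union_le _ _)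
  unfold htSkew
  omega

lemma rows_le {D : Set Cell} (hD : D.Finite) {X : Set ℕ} (h : ∀ i ∈ X, ∃ j, (i, j) ∈ D) :
    X.ncard ≤ D.ncard := by
  have : X ⊆ Prod.fst '' D := by
    intro i hi
    obtain ⟨j, hj⟩ := h i hi
    exact ⟨(i, j), hj, rfl⟩
  exact (Set.ncard_le_ncard this (hD.image _)).trans (Set.ncard_image_le hD)

/-- The strip acts last. -/
lemma ht_last {k : ℕ} (hk : 1 ≤ k) {d e : Word k} (hd : d.Pairwise (fun x y => y ≠ x + 1))
    {S S' : Set Cell} (hS : IsCore k S) (h : starCW k (d ++ e) (some S) = some S') :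
    htSkew (pMap k S' \ pMap k S) ≤ e.length := by
  obtain ⟨T, h1, h2⟩ := starCW_append_some h
  have a := starCW_core hk hS h1
  have b := starCW_core hk a.1 h2
  have s := strip_pr a.1 b.1 b.2.1 (starCW_hstrip hd a.1.1 h2)
  refine (htSkew_le ((pMap_young b.1).1.subset Set.diff_subset)).trans ?_
  refine le_trans (rows_le ((pMap_young a.1).1.subset (Set.diff_subset (t := pMap k S))) ?_) a.2.2.2
  rintro i ⟨j, ⟨h3, h4⟩, ⟨h5, h6⟩⟩
  refine ⟨j, ?_, h4⟩
  rw [pMap_eq] at h5 ⊢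
  exact lt_of_lt_of_le h5 (s i)

/-- The strip acts first. -/
lemma ht_first {k : ℕ} (hk : 1 ≤ k) {d e : Word k} (hd : d.Pairwise (fun x y => y ≠ x + 1))
    {S S' : Set Cell} (hS : IsCore k S) (h : starCW k (e ++ d) (some S) = some S') :
    htSkew (pMap k S' \ pMap k S) ≤ e.length := by
  obtain ⟨T, h1, h2⟩ := starCW_append_some h
  have a := starCW_core hk hS h1
  have b := starCW_core hk a.1 h2
  have s := strip_pr hS a.1 a.2.1 (starCW_hstrip hd hS.1 h1)
  refine (htSkew_le ((pMap_young b.1).1.subset Set.diff_subset)).trans ?_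
  have hinj : ({i : ℕ | ∃ j, (i, j) ∈ pMap k S' \ pMap k S ∧ (i + 1, j) ∈ pMap k S' \ pMap k S}).ncard =
      ((fun i => i + 1) '' {i : ℕ | ∃ j, (i, j) ∈ pMap k S' \ pMap k S ∧
        (i + 1, j) ∈ pMap k S' \ pMap k S}).ncard :=
    (Set.ncard_image_of_injective _ (fun a b h => by simpa using h)).symm
  rw [hinj]
  refine le_trans (rows_le ((pMap_young b.1).1.subset (Set.diff_subset (t := pMap k T))) ?_) b.2.2.2
  rintro _ ⟨i, ⟨j, ⟨h3, h4⟩, ⟨h5, h6⟩⟩, rfl⟩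
  refine ⟨j, h5, ?_⟩
  intro h7
  apply h4
  rw [pMap_eq] at h7 ⊢
  exact lt_of_lt_of_le h7 (s i)


lemma conn_of_cands {k : ℕ} {S : Finset (Idx k)} (hS : S ≠ Finset.univ)
    (h : ¬ (candsS k S).Nonempty) : IsKConnectedSet k S := by
  refine ⟨hS, ?_⟩
  intro i hi j hj m h1 h2
  by_contra hm
  apply h
  obtain ⟨i', hi', hi2⟩ := (S.filter (fun x => pos k S x ≤ pos k S m)).exists_max_image (pos k S)
    ⟨i, Finset.mem_filter.2 ⟨hi, h1⟩⟩
  obtain ⟨j', hj', hj2⟩ := (S.filter (fun x => pos k S m ≤ pos k S x)).exists_min_image (pos k S)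
    ⟨j, Finset.mem_filter.2 ⟨hj, h2⟩⟩
  rw [Finset.mem_filter] at hi' hj'
  have a1 : pos k S i' ≠ pos k S m := by
    intro e
    rw [pos_eq, pos_eq] at e
    rw [pg_inj k _ e] at hi'
    exact hm hi'.1
  have a2 : pos k S j' ≠ pos k S m := by
    intro e
    rw [pos_eq, pos_eq] at e
    rw [pg_inj k _ e] at hj'
    exact hm hj'.1
  refine ⟨j', ?_⟩
  unfold candsS
  rw [Finset.mem_filter]
  refine ⟨hj'.1, i', hi'.1, by omega, ?_, ?_⟩
  · rintro rfl
    have := pg_succ k (gap k S) i' (by rintro e; rw [e] at hi'; exact gap_notMem hS hi'.1)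
    simp only [pos_eq] at *
    omega
  · rintro b hb ⟨b1, b2⟩
    rcases le_total (pos k S b) (pos k S m) with hle | hle
    · have := hi2 b (Finset.mem_filter.2 ⟨hb, hle⟩); omega
    · have := hj2 b (Finset.mem_filter.2 ⟨hb, hle⟩); omega

lemma kconj_pMap {k : ℕ} {S : Set Cell} (hS : IsCore k S) :
    kconj k (pMap k S) = pMap k (transposeSet S) := by
  unfold kconj; rw [pInv_pMap hS]

/-- remove the doubled letter -/
lemma W_reduce {k : ℕ} (hk : 1 ≤ k) {p : Pr k} (hm : mn k (p.1 ∪ p.2) ∈ p.2) {S S' : Set Cell}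
    (hS : IsYoung S) (h : starCW k (W k p) (some S) = some S') :
    starCW k (dw k (gap k (p.1 ∪ p.2)) (p.1.erase (mn k (p.1 ∪ p.2))) ++
      mn k (p.1 ∪ p.2) :: iw k (gap k (p.1 ∪ p.2)) (p.2.erase (mn k (p.1 ∪ p.2)))) (some S)
      = some S' := by
  have e2 := iw_min (g := gap k (p.1 ∪ p.2)) hm
    (fun y hy => mn_le (Finset.mem_union_right _ hy))
  by_cases hA : mn k (p.1 ∪ p.2) ∈ p.1
  · have e1 := dw_min (g := gap k (p.1 ∪ p.2)) hA
      (fun y hy => mn_le (Finset.mem_union_left _ hy))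
    rw [W, e1, e2, List.append_assoc, starCW_append, List.singleton_append, starCW_cons,
      starCW_cons] at h
    rw [starCW_append, starCW_cons]
    cases hT : starCW k (iw k (gap k (p.1 ∪ p.2)) (p.2.erase (mn k (p.1 ∪ p.2)))) (some S) with
    | none => rw [hT] at h; exact h
    | some T =>
      rw [hT, starC_idem hk (starCW_young hS hT)] at h
      exact h
  · rw [W, e2] at h
    rw [Finset.erase_eq_of_notMem hA]
    exact h

lemma K_main {k r : ℕ} (hk : 1 ≤ k) (hr : r ≤ k) {p : Pr k}
    (hp : p ∈ NPairs k r) (hw : wt k p ≠ 0) {S S' : Set Cell} (hS : IsCore k S)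
    (h : starCW k (W k p) (some S) = some S') : Kconds k r (pMap k S) (pMap k S') := by
  have hP : p ∈ Pairs k r := (Finset.mem_filter.1 hp).1
  have hU := Pairs_ne hr hP
  rw [mem_NPairs] at hp
  obtain ⟨hcard, hm⟩ := hp
  have hg := gap_notMem hU
  rw [Finset.mem_union, not_or] at hg
  have a := starCW_core hk hS h
  have htr := starCW_tr hS.1 h
  have b := starCW_core hk (core_tr hS) htr
  rw [Kconds, kconj_pMap hS, kconj_pMap a.1, pInv_pMap hS, pInv_pMap a.1]
  refine ⟨a.2.2.1, b.2.2.1, ?_, ?_, ?_, ?_⟩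
  · have := a.2.2.2
    rwa [length_W, hcard] at this
  · rintro ⟨i, j⟩ ⟨c1, c2, c3, c4⟩
    simp only at c1 c2 c3 c4
    obtain ⟨T, h1, h2⟩ := starCW_append_some h
    have hT := starCW_young hS.1 h1
    have s1 := starCW_hstrip (dw_noSucc hg.1) hT h2
    have h1' := starCW_tr hS.1 h1
    have s2 := starCW_hstrip (neg_dtype (iw_noPred hg.2)) (young_tr hS.1) h1'
    by_cases hc : (i + 1, j + 1) ∈ T
    · exact c2.2 (s2 j (i + 1) hc c4.2)
    · exact c1.2 (s2 j i (s1 i (j + 1) c4.1 hc) c3.2)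
  · have hsub : residSupp k (S' \ S) ⊆ p.1 ∪ p.2 := by
      intro x hx
      unfold residSupp at hx
      rw [Set.Finite.mem_toFinset] at hx
      obtain ⟨c, hc, rfl⟩ := hx
      rw [← supp_W]
      unfold supp
      rw [List.mem_toFinset]
      exact starCW_res h c hc.1 hc.2
    have hle := Finset.card_le_card hsub
    have hui := Finset.card_union_add_card_inter p.1 p.2
    by_cases hd : (p.1 ∩ p.2).Nonempty
    · right
      have := Finset.card_pos.2 hd
      omega
    · have hmA : mn k (p.1 ∪ p.2) ∉ p.1 := fun hA => hd ⟨_, Finset.mem_inter.2 ⟨hA, hm⟩⟩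
      have hWC : WCp k p := by
        by_contra hcon
        apply hw
        unfold wt
        rw [if_pos hmA, if_neg hcon]
      rcases hWC with hc | hc
      · by_cases e : residSupp k (S' \ S) = p.1 ∪ p.2
        · left; rw [e]; exact conn_of_cands hU hc
        · right
          have := Finset.card_lt_card (Finset.ssubset_iff_subset_ne.2 ⟨hsub, e⟩)
          omega
      · exact absurd ⟨_, Finset.mem_inter.2 hc⟩ hd
  · have h' := W_reduce hk hm hS.1 h
    set v := mn k (p.1 ∪ p.2) with hv
    set gp := gap k (p.1 ∪ p.2) with hgp
    have hvg : gp ≠ v := by rintro e; rw [e] at hg; exact hg.2 hm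
    have hd : dw k gp (insert v p.1) = dw k gp (p.1.erase v) ++ [v] := by
      have := dw_min (g := gp) (v := v) (B := insert v p.1) (Finset.mem_insert_self _ _) (by
        intro y hy
        rcases Finset.mem_insert.1 hy with rfl | hy
        · exact le_rfl
        · exact mn_le (Finset.mem_union_left _ hy))
      rw [this]
      congr 2
      ext x; simp only [Finset.mem_erase, Finset.mem_insert]; tauto
    have hi := iw_min (g := gp) hm (fun y hy => mn_le (Finset.mem_union_right _ hy))
    have t1 : htSkew (pMap k S' \ pMap k S) ≤ p.2.card - 1 := by
      have h3 : starCW k (dw k gp (insert v p.1) ++ iw k gp (p.2.erase v)) (some S) = some S' := by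
        rw [hd, List.append_assoc]; exact h'
      have := ht_last hk (dw_noSucc (by
        rw [Finset.mem_insert, not_or]; exact ⟨hvg, hg.1⟩)) hS h3
      rwa [iw_length, Finset.card_erase_of_mem hm] at this
    have t2 : htSkew (pMap k (transposeSet S') \ pMap k (transposeSet S)) ≤ p.1.card := by
      have h3 := starCW_tr hS.1 h'
      rw [← hi, List.map_append] at h3
      have := ht_first hk (neg_dtype (iw_noPred hg.2)) (core_tr hS) h3
      rw [List.length_map, dw_length] at this
      exact this.trans (Finset.card_le_card (Finset.erase_subset _ _))
    have := Finset.card_pos.2 ⟨_, hm⟩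
    omega


/-! ### Final assembly -/

def Fn (k : ℕ) {R : Type*} [CommRing R] (g : Set Cell → R) (lam : Set Cell) (t : ℕ)
    (o : Option (Set Cell)) : R :=
  (o.map (pMap k)).elim 0 fun mu => msign R ((t : ℤ) - mu.ncard + lam.ncard) * g mu

lemma msign_mul {R : Type*} [CommRing R] (a b : ℤ) : msign R a * msign R b = msign R (a + b) := by
  unfold msign; rw [zpow_add]; push_cast; rfl

lemma sum_triangle {E : Type*} [AddCommGroup E] (f : ℕ → E) (n : ℕ) :
    ∑ i ∈ Finset.range n, ∑ b ∈ Finset.range (i + 1), f b =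
      ∑ b ∈ Finset.range n, ((n : ℤ) - b) • f b := by
  induction n with
  | zero => simp
  | succ n ih =>
    rw [Finset.sum_range_succ, ih, Finset.sum_range_succ, Finset.sum_range_succ, ← add_assoc,
      ← Finset.sum_add_distrib]
    congr 1
    · apply Finset.sum_congr rfl
      intro b _
      have : ((n + 1 : ℕ) : ℤ) - b = ((n : ℤ) - b) + 1 := by push_cast; ring
      rw [this, add_smul, one_smul]
    · have : ((n + 1 : ℕ) : ℤ) - n = 1 := by push_cast; ring
      rw [this, one_smul]

lemma pR_eq {R : Type*} [CommRing R] (h e : ℕ → R) (r : ℕ) :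
    pR h e r = ∑ b ∈ Finset.range (r + 1),
      ((-1 : ℤ) ^ b * ((r - b : ℕ) : ℤ)) • (h (r - b) * e b) := by
  unfold pR
  have h1 : ∀ i ∈ Finset.range r, ∑ j ∈ Finset.range (i + 1),
      ((-1 : ℤ) ^ (i + j)) • (h (r - i + j) * e (i - j)) =
      ∑ b ∈ Finset.range (i + 1), ((-1 : ℤ) ^ b) • (h (r - b) * e b) := by
    intro i hi
    rw [Finset.mem_range] at hi
    rw [← Finset.sum_range_reflect]
    apply Finset.sum_congr rfl
    intro j hj
    rw [Finset.mem_range] at hj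
    have e1 : i + 1 - 1 - j = i - j := by omega
    rw [e1]
    have e2 : r - i + (i - j) = r - j := by omega
    have e3 : i - (i - j) = j := by omega
    rw [e2, e3]
    congr 1
    have e4 : i + (i - j) = 2 * (i - j) + j := by omega
    rw [e4, pow_add, pow_mul]; simp
  rw [Finset.sum_congr rfl h1, sum_triangle, Finset.sum_range_succ]
  simp only [Nat.sub_self, Nat.cast_zero, mul_zero, zero_smul, add_zero]
  apply Finset.sum_congr rfl
  intro b hb
  rw [Finset.mem_range] at hb
  rw [smul_smul, mul_comm, Nat.cast_sub hb.le]

lemma sum_Pairs {E : Type*} [AddCommGroup E] (k r : ℕ) (G : Pr k → E) :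
    ∑ p ∈ Pairs k r, G p = ∑ b ∈ Finset.range (r + 1),
      ∑ B ∈ Finset.powersetCard b (Finset.univ : Finset (Idx k)),
        ∑ A ∈ Finset.powersetCard (r - b) (Finset.univ : Finset (Idx k)), G (A, B) := by
  rw [← Finset.sum_fiberwise_of_maps_to (s := Pairs k r) (t := Finset.range (r + 1))
    (g := fun p => p.2.card)]
  · apply Finset.sum_congr rfl
    intro b hb
    rw [Finset.mem_range] at hb
    rw [← Finset.sum_product_right]
    apply Finset.sum_congr _ (fun _ _ => rfl)
    ext ⟨A, B⟩
    simp only [Pairs, Finset.mem_filter, Finset.mem_univ, true_and, Finset.mem_product,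
      Finset.mem_powersetCard, Finset.subset_univ]
    omega
  · intro p hp
    simp only [Pairs, Finset.mem_filter, Finset.mem_univ, true_and] at hp
    rw [Finset.mem_range]; omega

lemma pieri_comb (k : ℕ) (hk : 1 ≤ k)
    {R : Type*} [CommRing R] (hR eR : ℕ → R) (g : Set Cell → R)
    (hPieriH : ∀ lam : Set Cell, IsBounded k lam → ∀ r : ℕ, r ≤ k →
      hR r * g lam = ∑ A ∈ Finset.powersetCard r (Finset.univ : Finset (Idx k)),
        (starB k (dwordOf k A) lam).elim 0 fun mu =>
          msign R ((r : ℤ) - mu.ncard + lam.ncard) * g mu)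
    (hPieriE : ∀ lam : Set Cell, IsBounded k lam → ∀ r : ℕ, r ≤ k →
      eR r * g lam = ∑ B ∈ Finset.powersetCard r (Finset.univ : Finset (Idx k)),
        (starB k (iwordOf k B) lam).elim 0 fun mu =>
          msign R ((r : ℤ) - mu.ncard + lam.ncard) * g mu)
    (r : ℕ) (hrk : r ≤ k) (lam : Set Cell) (hlam : IsBounded k lam) (b : ℕ) (hb : b ≤ r) :
    hR (r - b) * eR b * g lam =
      ∑ B ∈ Finset.powersetCard b (Finset.univ : Finset (Idx k)),
        ∑ A ∈ Finset.powersetCard (r - b) (Finset.univ : Finset (Idx k)),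
          Fn k g lam r (starCW k (dwordOf k A ++ iwordOf k B) (some (pInv k lam))) := by
  rw [mul_assoc, hPieriE lam hlam b (by omega), Finset.mul_sum]
  apply Finset.sum_congr rfl
  intro B _
  unfold starB
  cases hT : starCW k (iwordOf k B) (some (pInv k lam)) with
  | none =>
    simp only [Option.map_none, Option.elim_none, mul_zero]
    symm
    apply Finset.sum_eq_zero
    intro A _
    rw [starCW_append, hT, starCW_none]; rfl
  | some T =>
    have hc := (starCW_core hk (pInv_core hlam) hT).1
    simp only [Option.map_some, Option.elim_some]
    rw [mul_left_comm, hPieriH _ (pMap_bounded hc) (r - b) (by omega), Finset.mul_sum]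
    apply Finset.sum_congr rfl
    intro A _
    rw [starCW_append, hT]
    unfold starB Fn
    rw [pInv_pMap hc]
    cases starCW k (dwordOf k A) (some T) with
    | none => simp
    | some U =>
      simp only [Option.map_some, Option.elim_some]
      rw [← mul_assoc, msign_mul]
      congr 2
      rw [Nat.cast_sub hb]
      ring

lemma pR_expand (k : ℕ) (hk : 1 ≤ k)
    {R : Type*} [CommRing R] (hR eR : ℕ → R) (g : Set Cell → R)
    (hPieriH : ∀ lam : Set Cell, IsBounded k lam → ∀ r : ℕ, r ≤ k →
      hR r * g lam = ∑ A ∈ Finset.powersetCard r (Finset.univ : Finset (Idx k)),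
        (starB k (dwordOf k A) lam).elim 0 fun mu =>
          msign R ((r : ℤ) - mu.ncard + lam.ncard) * g mu)
    (hPieriE : ∀ lam : Set Cell, IsBounded k lam → ∀ r : ℕ, r ≤ k →
      eR r * g lam = ∑ B ∈ Finset.powersetCard r (Finset.univ : Finset (Idx k)),
        (starB k (iwordOf k B) lam).elim 0 fun mu =>
          msign R ((r : ℤ) - mu.ncard + lam.ncard) * g mu)
    (r : ℕ) (hr1 : 1 ≤ r) (hrk : r ≤ k) (lam : Set Cell) (hlam : IsBounded k lam) :
    pR hR eR r * g lam =
      ∑ p ∈ NPairs k r, wt k p • Fn k g lam r (starCW k (W k p) (some (pInv k lam))) := by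
  have hY : ∀ S, some (pInv k lam) = some S → IsYoung S := by
    intro S hS; rw [← Option.some.inj hS]; exact (pInv_core hlam).1
  have main := main_identity (aY k) (fun φ : Function.End YO =>
    Fn k g lam r (φ ⟨some (pInv k lam), hY⟩).1) (fun i j h => aY_comm h) hr1 hrk
  simp only [aY_prod] at main
  rw [← main, sum_Pairs, pR_eq, Finset.sum_mul]
  apply Finset.sum_congr rfl
  intro b hb
  rw [Finset.mem_range] at hb
  rw [smul_mul_assoc, pieri_comb k hk hR eR g hPieriH hPieriE r hrk lam hlam b (by omega),
    Finset.smul_sum]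
  apply Finset.sum_congr rfl
  intro B hB
  rw [Finset.smul_sum]
  apply Finset.sum_congr rfl
  intro A hA
  rw [(Finset.mem_powersetCard.1 hA).2, (Finset.mem_powersetCard.1 hB).2]

lemma K_starB {k r : ℕ} (hk : 1 ≤ k) (hr : r ≤ k) {lam mu : Set Cell} (hlam : IsBounded k lam)
    {p : Pr k} (hp : p ∈ NPairs k r) (hw : wt k p ≠ 0) (h : starB k (W k p) lam = some mu) :
    IsBounded k mu ∧ Kconds k r lam mu := by
  unfold starB at h
  rw [Option.map_eq_some_iff] at h
  obtain ⟨S', h1, rfl⟩ := h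
  have h2 := K_main hk hr hp hw (pInv_core hlam) h1
  rw [pMap_pInv hlam] at h2
  exact ⟨pMap_bounded (starCW_core hk (pInv_core hlam) h1).1, h2⟩


theorem statement11 (k : ℕ) (hk : 1 ≤ k)
    (R : Type*) [CommRing R]
    (hR eR : ℕ → R) (hR0 : hR 0 = 1) (eR0 : eR 0 = 1)
    (g : Set Cell → R) (hg0 : g ∅ = 1)
    (hPieriH : ∀ lam : Set Cell, IsBounded k lam → ∀ r : ℕ, r ≤ k →
      hR r * g lam = ∑ A ∈ Finset.powersetCard r (Finset.univ : Finset (Idx k)),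
        (starB k (dwordOf k A) lam).elim 0 fun mu =>
          msign R ((r : ℤ) - mu.ncard + lam.ncard) * g mu)
    (hPieriE : ∀ lam : Set Cell, IsBounded k lam → ∀ r : ℕ, r ≤ k →
      eR r * g lam = ∑ B ∈ Finset.powersetCard r (Finset.univ : Finset (Idx k)),
        (starB k (iwordOf k B) lam).elim 0 fun mu =>
          msign R ((r : ℤ) - mu.ncard + lam.ncard) * g mu)
    (r : ℕ) (hr1 : 1 ≤ r) (hrk : r ≤ k) (lam : Set Cell) (hlam : IsBounded k lam) :
    pR hR eR r * g lam =
      (∑ᶠ mu ∈ {mu : Set Cell | IsBounded k mu ∧ Kconds k r lam mu},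
        msign R ((r : ℤ) - mu.ncard + lam.ncard) *
          (MNcoeff k r (fun u => starB k u lam = some mu) • g mu)) ∧
    ∀ mu : Set Cell, IsBounded k mu → ¬Kconds k r lam mu →
      MNcoeff k r (fun u => starB k u lam = some mu) = 0 := by
  have key : ∀ mu : Set Cell, (∀ p ∈ NPairs k r, wt k p ≠ 0 → starB k (W k p) lam ≠ some mu) →
      MNcoeff k r (fun u => starB k u lam = some mu) = 0 := by
    intro mu h
    rw [MNcoeff_eq hrk]
    apply Finset.sum_eq_zero
    intro p hp
    by_cases hw : wt k p = 0
    · simp [hw]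
    · rw [if_neg (h p hp hw)]
  refine ⟨?_, ?_⟩
  · rw [pR_expand k hk hR eR g hPieriH hPieriE r hr1 hrk lam hlam]
    set T : Finset (Set Cell) := ((NPairs k r).filter (fun p => wt k p ≠ 0)).biUnion
      (fun p => (starB k (W k p) lam).toFinset) with hT
    have memT : ∀ mu, mu ∈ T ↔ ∃ p ∈ NPairs k r, wt k p ≠ 0 ∧ starB k (W k p) lam = some mu := by
      intro mu
      rw [hT]
      simp only [Finset.mem_biUnion, Finset.mem_filter, Option.mem_toFinset, Option.mem_def,
        and_assoc]
    rw [finsum_mem_eq_sum_of_inter_support_eq (t := T)]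
    · simp only [MNcoeff_eq hrk, Finset.sum_smul, Finset.mul_sum]
      rw [Finset.sum_comm]
      apply Finset.sum_congr rfl
      intro p hp
      by_cases hw : wt k p = 0
      · simp [hw]
      cases hS : starB k (W k p) lam with
      | none =>
        have : Fn k g lam r (starCW k (W k p) (some (pInv k lam))) = 0 := by
          unfold starB at hS
          unfold Fn
          rw [hS]; rfl
        rw [this, smul_zero]
        symm
        apply Finset.sum_eq_zero
        intro mu _
        simp
      | some nu =>
        have : Fn k g lam r (starCW k (W k p) (some (pInv k lam))) =
            msign R ((r : ℤ) - nu.ncard + lam.ncard) * g nu := by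
          unfold starB at hS
          unfold Fn
          rw [hS]; rfl
        rw [this, Finset.sum_eq_single nu]
        · rw [if_pos rfl, mul_smul_comm]
        · intro mu _ hne
          rw [if_neg (fun h => hne (Option.some.inj h).symm), zero_smul, mul_zero]
        · intro hn
          exact absurd ((memT nu).2 ⟨p, hp, hw, hS⟩) hn
    · ext mu
      constructor
      · rintro ⟨-, h2⟩
        refine ⟨?_, h2⟩
        rw [Finset.mem_coe, memT]
        by_contra hcon
        push Not at hcon
        apply h2
        simp only
        rw [key mu hcon, zero_smul, mul_zero]
      · rintro ⟨h1, h2⟩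
        refine ⟨?_, h2⟩
        rw [Finset.mem_coe, memT] at h1
        obtain ⟨p, hp, hw, hS⟩ := h1
        exact K_starB hk hrk hlam hp hw hS
  · intro mu _ hmu
    apply key
    intro p hp hw hS
    exact hmu (K_starB hk hrk hlam hp hw hS).2

end MN

end
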